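/- arXiv:2603.26993 — 4 statements merged into one kernel-verified Lean document; each statement's English description precedes it below -/
import Mathlib

section
/- Let S and T be two information states about Y, both taking values in standard Borel spaces. If S is not Blackwell-dominated by T as an experiment about Y, then there exist a finite action set 𝒜̃ and a bounded loss ℓ̃ : 𝒜̃ × 𝒴 → ℝ such that V(S;ℓ̃) < V(T;ℓ̃). -/
open MeasureTheory ProbabilityTheory ENNReal

/-- The universal completion of a measurable space `m` on `α`: a set is measurable iff it is
null-measurable with respect to every finite measure on `(α, m)`. -/
def MeasurableSpace.univCompletion {α : Type*} (m : MeasurableSpace α) :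
    MeasurableSpace α where
  MeasurableSet' s :=
    ∀ (μ : @MeasureTheory.Measure α m), MeasureTheory.IsFiniteMeasure μ →
      @MeasureTheory.NullMeasurableSet α m s μ
  measurableSet_empty := fun μ _ => (@MeasurableSet.empty α m).nullMeasurableSet
  measurableSet_compl := fun _ hs μ hμ => (hs μ hμ).compl
  measurableSet_iUnion := fun _ hf μ hμ =>
    MeasureTheory.NullMeasurableSet.iUnion fun i => hf i μ hμ

/-- Bayes risk of the decision problem with loss `ℓ`, target `Y` and information state `H`:
the infimum of the expected loss over all decision rules that are measurable with respect to
the universal completion of the σ-algebra of the value space of `H`. -/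
noncomputable def BayesRisk {Ω ℋ 𝒜 𝒴 : Type*} [MeasurableSpace Ω]
    (mℋ : MeasurableSpace ℋ) [MeasurableSpace 𝒜] [MeasurableSpace 𝒴]
    (P : Measure Ω) (H : Ω → ℋ) (Y : Ω → 𝒴) (ℓ : 𝒜 → 𝒴 → ℝ) : ℝ :=
  ⨅ δ : {δ : ℋ → 𝒜 // Measurable[mℋ.univCompletion] δ},
    ∫ ω, ℓ (δ.1 (H ω)) (Y ω) ∂P

/-- `S` is Blackwell-dominated by `T` as an experiment about `Y` if the joint law of `(S, Y)`
coincides with the joint law of a garbling of `T` together with `Y`, i.e. the law obtained by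
applying a Markov kernel to `T`, conditionally independently of `Y` given `T`. -/
def BlackwellDominated {Ω 𝒮 𝒯 𝒴 : Type*}
    [MeasurableSpace Ω] [MeasurableSpace 𝒮] [MeasurableSpace 𝒯] [MeasurableSpace 𝒴]
    (P : Measure Ω) (S : Ω → 𝒮) (T : Ω → 𝒯) (Y : Ω → 𝒴) : Prop :=
  ∃ κ : Kernel 𝒯 𝒮, IsMarkovKernel κ ∧
    P.map (fun ω => (S ω, Y ω)) =
      (P.map (fun ω => (T ω, Y ω))).bind (fun p => (κ p.1).map (fun s => (s, p.2)))

/-- A positive linear functional on the image of `J`, pulled back to `p` along `J`, extends to a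
positive linear functional on the whole space. -/
theorem exists_positive_extension_of_map {E F : Type*} [AddCommGroup E] [Module ℝ E]
    [AddCommGroup F] [Module ℝ F] (C : PointedCone ℝ E) (J : F →ₗ[ℝ] E) (p : F →ₗ[ℝ] ℝ)
    (hpos : ∀ x, J x ∈ C → 0 ≤ p x) (hdom : ∀ u, ∃ x, J x + u ∈ C) :
    ∃ Λ : E →ₗ[ℝ] ℝ, (∀ x, Λ (J x) = p x) ∧ ∀ u ∈ C, 0 ≤ Λ u := by
  have hker : p ∈ (LinearMap.ker J).dualAnnihilator := by
    rw [Submodule.mem_dualAnnihilator]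
    intro x hx
    rw [LinearMap.mem_ker] at hx
    have h₁ := hpos x (by rw [hx]; exact C.zero_mem)
    have h₂ := hpos (-x) (by rw [map_neg, hx, neg_zero]; exact C.zero_mem)
    rw [map_neg] at h₂
    linarith
  rw [← LinearMap.range_dualMap_eq_dualAnnihilator_ker] at hker
  obtain ⟨f, rfl⟩ := hker
  obtain ⟨Λ, hΛ, hΛC⟩ := riesz_extension C ⟨LinearMap.range J, f.domRestrict _⟩
    (by rintro ⟨_, x, rfl⟩ hx; exact hpos x hx)
    (fun u => let ⟨x, hx⟩ := hdom u; ⟨⟨J x, x, rfl⟩, hx⟩)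
  exact ⟨Λ, fun x => hΛ ⟨J x, x, rfl⟩, hΛC⟩

/-- The space of bounded real functions on `W`. -/
def boundedFunctions (W : Type*) : Submodule ℝ (W → ℝ) where
  carrier := {u | ∃ C, ∀ w, |u w| ≤ C}
  add_mem' := by
    rintro u v ⟨C, hC⟩ ⟨D, hD⟩
    exact ⟨C + D, fun w => (abs_add_le _ _).trans (add_le_add (hC w) (hD w))⟩
  zero_mem' := ⟨0, fun w => by simp⟩
  smul_mem' := by
    rintro c u ⟨C, hC⟩
    refine ⟨|c| * C, fun w => ?_⟩
    rw [Pi.smul_apply, smul_eq_mul, abs_mul]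
    exact mul_le_mul_of_nonneg_left (hC w) (abs_nonneg c)

/-- The space of bounded measurable real functions on `W`. -/
def boundedMeasurable (W : Type*) [MeasurableSpace W] : Submodule ℝ (W → ℝ) where
  carrier := {u | Measurable u ∧ u ∈ boundedFunctions W}
  add_mem' := fun hu hv => ⟨hu.1.add hv.1, add_mem hu.2 hv.2⟩
  zero_mem' := ⟨measurable_const, zero_mem _⟩
  smul_mem' := fun c _ hu => ⟨hu.1.const_smul c, Submodule.smul_mem _ c hu.2⟩

/-- The cone of nonnegative bounded measurable functions. -/
def nonnegBoundedMeasurable (W : Type*) [MeasurableSpace W] :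
    PointedCone ℝ (boundedMeasurable W) where
  carrier := {u | ∀ w, 0 ≤ u.1 w}
  add_mem' := fun hu hv w => add_nonneg (hu w) (hv w)
  zero_mem' := fun _ => le_rfl
  smul_mem' := fun c _ hu w => mul_nonneg c.2 (hu w)

section Bounded

variable {W V : Type*}

theorem const_mem_boundedFunctions (c : ℝ) : (fun _ : W => c) ∈ boundedFunctions W :=
  ⟨|c|, fun _ => le_rfl⟩

theorem mul_mem_boundedFunctions {u v : W → ℝ} (hu : u ∈ boundedFunctions W)
    (hv : v ∈ boundedFunctions W) : (fun w => u w * v w) ∈ boundedFunctions W := by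
  obtain ⟨C, hC⟩ := hu
  obtain ⟨D, hD⟩ := hv
  refine ⟨C * D, fun w => ?_⟩
  rw [abs_mul]
  exact mul_le_mul (hC w) (hD w) (abs_nonneg _) ((abs_nonneg _).trans (hC w))

theorem comp_mem_boundedFunctions {u : W → ℝ} (hu : u ∈ boundedFunctions W) (φ : V → W) :
    (fun v => u (φ v)) ∈ boundedFunctions V := by
  obtain ⟨C, hC⟩ := hu
  exact ⟨C, fun v => hC _⟩

variable [MeasurableSpace W] [MeasurableSpace V]

theorem const_mem_boundedMeasurable (c : ℝ) : (fun _ : W => c) ∈ boundedMeasurable W :=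
  ⟨measurable_const, const_mem_boundedFunctions c⟩

theorem mul_mem_boundedMeasurable {u v : W → ℝ} (hu : u ∈ boundedMeasurable W)
    (hv : v ∈ boundedMeasurable W) : (fun w => u w * v w) ∈ boundedMeasurable W :=
  ⟨hu.1.mul hv.1, mul_mem_boundedFunctions hu.2 hv.2⟩

theorem abs_mem_boundedMeasurable {u : W → ℝ} (hu : u ∈ boundedMeasurable W) :
    (fun w => |u w|) ∈ boundedMeasurable W := by
  obtain ⟨hm, C, hC⟩ := hu
  exact ⟨continuous_abs.measurable.comp hm, C, fun w => by rw [abs_abs]; exact hC w⟩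

theorem comp_mem_boundedMeasurable {u : W → ℝ} (hu : u ∈ boundedMeasurable W) {φ : V → W}
    (hφ : Measurable φ) : (fun v => u (φ v)) ∈ boundedMeasurable V :=
  ⟨hu.1.comp hφ, comp_mem_boundedFunctions hu.2 φ⟩

theorem indicator_one_mem_boundedMeasurable {B : Set W} (hB : MeasurableSet B) :
    B.indicator (1 : W → ℝ) ∈ boundedMeasurable W := by
  refine ⟨measurable_one.indicator hB, 1, fun w => ?_⟩
  by_cases h : w ∈ B <;> simp [h]

theorem integrable_of_mem_boundedMeasurable {u : W → ℝ} (hu : u ∈ boundedMeasurable W)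
    (μ : Measure W) [IsFiniteMeasure μ] : Integrable u μ := by
  obtain ⟨hm, C, hC⟩ := hu
  exact Integrable.of_bound hm.aestronglyMeasurable C (Filter.Eventually.of_forall hC)

theorem continuous_mem_boundedMeasurable [TopologicalSpace W] [CompactSpace W]
    [OpensMeasurableSpace W] {u : W → ℝ} (hu : Continuous u) : u ∈ boundedMeasurable W := by
  refine ⟨hu.measurable, ?_⟩
  obtain ⟨C, hC⟩ := isCompact_univ.exists_bound_of_continuousOn hu.continuousOn
  exact ⟨C, fun w => hC w trivial⟩

theorem simpleFunc_mem_boundedMeasurable (h : SimpleFunc W (boundedMeasurable V)) :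
    (fun p : W × V => (h p.1).1 p.2) ∈ boundedMeasurable (W × V) := by
  refine ⟨(h.comp Prod.fst measurable_fst).measurable_bind (fun g p => g.1 p.2)
    fun g => g.2.1.comp measurable_snd, ?_⟩
  choose c hc using fun g : boundedMeasurable V => g.2.2
  obtain ⟨C, hC⟩ := (h.map c).exists_forall_norm_le
  exact ⟨C, fun p => (hc _ _).trans ((le_abs_self _).trans (hC p.1))⟩

theorem kernel_integral_mem_boundedMeasurable (κ : Kernel W V) [IsMarkovKernel κ]
    {u : W × V → ℝ} (hu : u ∈ boundedMeasurable (W × V)) :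
    (fun w => ∫ v, u (w, v) ∂κ w) ∈ boundedMeasurable W := by
  obtain ⟨hm, C, hC⟩ := hu
  refine ⟨(hm.stronglyMeasurable.integral_kernel_prod_right'
    (κ := κ)).measurable, C, fun w => ?_⟩
  have := norm_integral_le_of_norm_le_const (μ := κ w) (f := fun v => u (w, v)) (C := C)
    (Filter.Eventually.of_forall fun v => hC (w, v))
  simpa using this

/-- Composition with a measurable map, as a linear map on bounded measurable functions. -/
def boundedMeasurableComp {φ : V → W} (hφ : Measurable φ) :
    boundedMeasurable W →ₗ[ℝ] boundedMeasurable V where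
  toFun u := ⟨fun v => u.1 (φ v), comp_mem_boundedMeasurable u.2 hφ⟩
  map_add' _ _ := rfl
  map_smul' _ _ := rfl

/-- The tensor product of two bounded measurable functions. -/
def boundedMeasurableTensor (f : boundedMeasurable V) (k : boundedMeasurable W) :
    boundedMeasurable (V × W) :=
  ⟨fun w => f.1 w.1 * k.1 w.2,
    mul_mem_boundedMeasurable (comp_mem_boundedMeasurable f.2 measurable_fst)
      (comp_mem_boundedMeasurable k.2 measurable_snd)⟩

/-- Integration against a finite measure, as a linear functional on bounded measurable
functions. -/
noncomputable def boundedMeasurableIntegral (μ : Measure W) [IsFiniteMeasure μ] :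
    boundedMeasurable W →ₗ[ℝ] ℝ where
  toFun u := ∫ w, u.1 w ∂μ
  map_add' u v := integral_add (integrable_of_mem_boundedMeasurable u.2 μ)
    (integrable_of_mem_boundedMeasurable v.2 μ)
  map_smul' c _ := integral_const_mul c _

/-- A linear functional which is nonnegative on nonnegative functions. -/
def IsPositiveFunctional (Λ : boundedMeasurable W →ₗ[ℝ] ℝ) : Prop :=
  ∀ u, (∀ w, 0 ≤ u.1 w) → 0 ≤ Λ u

theorem isPositiveFunctional_boundedMeasurableIntegral (μ : Measure W) [IsFiniteMeasure μ] :
    IsPositiveFunctional (boundedMeasurableIntegral μ) :=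
  fun _ hu => integral_nonneg hu

theorem IsPositiveFunctional.comp_boundedMeasurableComp {Λ : boundedMeasurable V →ₗ[ℝ] ℝ}
    (hΛ : IsPositiveFunctional Λ) {φ : V → W} (hφ : Measurable φ) :
    IsPositiveFunctional (Λ ∘ₗ boundedMeasurableComp hφ) :=
  fun _ hu => hΛ _ fun v => hu (φ v)

theorem IsPositiveFunctional.abs_apply_le {Λ : boundedMeasurable W →ₗ[ℝ] ℝ}
    (hΛ : IsPositiveFunctional Λ) {u b : boundedMeasurable W} (h : ∀ w, |u.1 w| ≤ b.1 w) :
    |Λ u| ≤ Λ b := by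
  have h₁ := hΛ (b - u) fun w => sub_nonneg.2 ((le_abs_self _).trans (h w))
  have h₂ := hΛ (b + u) fun w =>
    neg_le_iff_add_nonneg.1 ((neg_le_abs (u.1 w)).trans (h w))
  rw [map_sub] at h₁
  rw [map_add] at h₂
  exact abs_le.2 ⟨by linarith, by linarith⟩

theorem exists_simpleFunc_abs_sub_le (u : boundedMeasurable W) {ε : ℝ} (hε : 0 < ε) :
    ∃ k : SimpleFunc W ℝ, ∀ w, |u.1 w - k w| ≤ ε := by
  obtain ⟨u, hm, C, hC⟩ := u
  have hfl : Measurable fun w => ⌊u w / ε⌋ := (hm.div_const ε).floor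
  let q : SimpleFunc W ℤ :=
    { toFun := fun w => ⌊u w / ε⌋
      measurableSet_fiber' := fun n => hfl (measurableSet_singleton n)
      finite_range' := by
        refine (Set.finite_Icc ⌊-C / ε⌋ ⌊C / ε⌋).subset ?_
        rintro _ ⟨w, rfl⟩
        have := abs_le.1 (hC w)
        exact ⟨Int.floor_le_floor (div_le_div_of_nonneg_right this.1 hε.le),
          Int.floor_le_floor (div_le_div_of_nonneg_right this.2 hε.le)⟩ }
  refine ⟨q.map fun n : ℤ => ε * (n : ℝ), fun w => ?_⟩
  change |u w - ε * (⌊u w / ε⌋ : ℝ)| ≤ ε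
  have h₁ : u w - ε * (⌊u w / ε⌋ : ℝ) = ε * Int.fract (u w / ε) := by
    rw [Int.fract, mul_sub, mul_div_cancel₀ _ hε.ne']
  rw [h₁, abs_of_nonneg (mul_nonneg hε.le (Int.fract_nonneg _))]
  exact mul_le_of_le_one_right hε.le (Int.fract_lt_one _).le

/-- A simple function, as a bounded measurable function. -/
def simpleFuncToBoundedMeasurable (k : SimpleFunc W ℝ) : boundedMeasurable W :=
  ⟨k, k.measurable, k.exists_forall_norm_le⟩

/-- Two positive functionals that agree on simple functions are equal. -/
theorem IsPositiveFunctional.ext_simpleFunc {Λ Ψ : boundedMeasurable W →ₗ[ℝ] ℝ}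
    (hΛ : IsPositiveFunctional Λ) (hΨ : IsPositiveFunctional Ψ)
    (h : ∀ k : SimpleFunc W ℝ,
      Λ (simpleFuncToBoundedMeasurable k) = Ψ (simpleFuncToBoundedMeasurable k)) :
    Λ = Ψ := by
  refine LinearMap.ext fun u => ?_
  let e : boundedMeasurable W := ⟨fun _ => 1, const_mem_boundedMeasurable 1⟩
  have he : ∀ {Φ : boundedMeasurable W →ₗ[ℝ] ℝ}, IsPositiveFunctional Φ → 0 ≤ Φ e :=
    fun hΦ => hΦ e fun _ => zero_le_one
  refine eq_of_abs_sub_le_all fun η hη => ?_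
  have hpos : 0 < Λ e + Ψ e + 1 := by linarith [he hΛ, he hΨ]
  have hε : 0 < η / (Λ e + Ψ e + 1) := div_pos hη hpos
  set ε := η / (Λ e + Ψ e + 1) with hε_def
  obtain ⟨k, hk⟩ := exists_simpleFunc_abs_sub_le u hε
  have hb : ∀ w, |(u - simpleFuncToBoundedMeasurable k).1 w| ≤ (ε • e).1 w := fun w =>
    (hk w).trans_eq (mul_one ε).symm
  have h₁ := hΛ.abs_apply_le hb
  have h₂ := hΨ.abs_apply_le hb
  rw [map_sub, map_smul, smul_eq_mul] at h₁ h₂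
  have h₃ : ε * (Λ e + Ψ e + 1) = η := div_mul_cancel₀ _ hpos.ne'
  have h₄ := h k
  rw [abs_le] at h₁ h₂ ⊢
  constructor <;> nlinarith

theorem IsPositiveFunctional.abs_tensor_sub_tensor_le {Λ : boundedMeasurable (V × W) →ₗ[ℝ] ℝ}
    (hΛ : IsPositiveFunctional Λ) {μ : Measure V} [IsFiniteMeasure μ] {ν : Measure W}
    [IsFiniteMeasure ν]
    (hfst : Λ ∘ₗ boundedMeasurableComp measurable_fst = boundedMeasurableIntegral μ)
    (hsnd : Λ ∘ₗ boundedMeasurableComp measurable_snd = boundedMeasurableIntegral ν)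
    {f c : boundedMeasurable V} {k d : boundedMeasurable W} {M K : ℝ}
    (hc : ∀ v, |c.1 v| ≤ M) (hk : ∀ w, |k.1 w| ≤ K) :
    |Λ (boundedMeasurableTensor f k) - Λ (boundedMeasurableTensor c d)| ≤
      K * ∫ v, |f.1 v - c.1 v| ∂μ + M * ∫ w, |k.1 w - d.1 w| ∂ν := by
  let a : boundedMeasurable V := ⟨_, abs_mem_boundedMeasurable (f - c).2⟩
  let b : boundedMeasurable W := ⟨_, abs_mem_boundedMeasurable (k - d).2⟩
  have ha : Λ (boundedMeasurableComp measurable_fst a) = ∫ v, |f.1 v - c.1 v| ∂μ :=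
    LinearMap.congr_fun hfst a
  have hb : Λ (boundedMeasurableComp measurable_snd b) = ∫ w, |k.1 w - d.1 w| ∂ν :=
    LinearMap.congr_fun hsnd b
  have hsum : K * Λ (boundedMeasurableComp measurable_fst a) +
      M * Λ (boundedMeasurableComp measurable_snd b) =
      Λ (K • boundedMeasurableComp measurable_fst a +
        M • boundedMeasurableComp measurable_snd b) := by
    rw [map_add, map_smul, map_smul, smul_eq_mul, smul_eq_mul]
  rw [← ha, ← hb, ← map_sub, hsum]
  refine hΛ.abs_apply_le fun p => ?_
  change |f.1 p.1 * k.1 p.2 - c.1 p.1 * d.1 p.2| ≤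
    K * |f.1 p.1 - c.1 p.1| + M * |k.1 p.2 - d.1 p.2|
  calc |f.1 p.1 * k.1 p.2 - c.1 p.1 * d.1 p.2|
      = |k.1 p.2 * (f.1 p.1 - c.1 p.1) + c.1 p.1 * (k.1 p.2 - d.1 p.2)| := by ring_nf
    _ ≤ |k.1 p.2 * (f.1 p.1 - c.1 p.1)| + |c.1 p.1 * (k.1 p.2 - d.1 p.2)| := abs_add_le _ _
    _ ≤ _ := by
      rw [abs_mul, abs_mul]
      exact add_le_add (mul_le_mul_of_nonneg_right (hk _) (abs_nonneg _))
        (mul_le_mul_of_nonneg_right (hc _) (abs_nonneg _))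

end Bounded

section Representation

variable {X Z : Type*} [MetricSpace X] [CompactSpace X] [MeasurableSpace X] [BorelSpace X]
  [MetricSpace Z] [CompactSpace Z] [MeasurableSpace Z] [BorelSpace Z]

/-- Two positive functionals on a product which share their marginal measures and agree on tensor
products of continuous functions agree on tensor products of bounded measurable functions. -/
theorem IsPositiveFunctional.tensor_eq_of_continuous {Λ Ψ : boundedMeasurable (X × Z) →ₗ[ℝ] ℝ}
    (hΛ : IsPositiveFunctional Λ) (hΨ : IsPositiveFunctional Ψ)
    {μ : Measure X} [IsFiniteMeasure μ] {ν : Measure Z} [IsFiniteMeasure ν]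
    (hΛfst : Λ ∘ₗ boundedMeasurableComp measurable_fst = boundedMeasurableIntegral μ)
    (hΛsnd : Λ ∘ₗ boundedMeasurableComp measurable_snd = boundedMeasurableIntegral ν)
    (hΨfst : Ψ ∘ₗ boundedMeasurableComp measurable_fst = boundedMeasurableIntegral μ)
    (hΨsnd : Ψ ∘ₗ boundedMeasurableComp measurable_snd = boundedMeasurableIntegral ν)
    (h : ∀ u : boundedMeasurable (X × Z), Continuous u.1 → Λ u = Ψ u)
    (f : boundedMeasurable X) (k : boundedMeasurable Z) :
    Λ (boundedMeasurableTensor f k) = Ψ (boundedMeasurableTensor f k) := by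
  refine eq_of_abs_sub_le_all fun η hη => ?_
  obtain ⟨K, hK⟩ := k.2.2
  have hK' : ∀ z, |k.1 z| ≤ |K| := fun z => (hK z).trans (le_abs_self K)
  obtain ⟨c, hc, -⟩ := (integrable_of_mem_boundedMeasurable f.2
    μ).exists_boundedContinuous_integral_sub_le (ε := η / (4 * (|K| + 1))) (by positivity)
  obtain ⟨d, hd, -⟩ := (integrable_of_mem_boundedMeasurable k.2
    ν).exists_boundedContinuous_integral_sub_le (ε := η / (4 * (‖c‖ + 1))) (by positivity)
  let c' : boundedMeasurable X := ⟨c, continuous_mem_boundedMeasurable c.continuous⟩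
  let d' : boundedMeasurable Z := ⟨d, continuous_mem_boundedMeasurable d.continuous⟩
  have hbound : ∀ {Φ : boundedMeasurable (X × Z) →ₗ[ℝ] ℝ}, IsPositiveFunctional Φ →
      Φ ∘ₗ boundedMeasurableComp measurable_fst = boundedMeasurableIntegral μ →
      Φ ∘ₗ boundedMeasurableComp measurable_snd = boundedMeasurableIntegral ν →
      |Φ (boundedMeasurableTensor f k) - Φ (boundedMeasurableTensor c' d')| ≤ η / 2 := by
    intro Φ hΦ h₁ h₂
    refine (hΦ.abs_tensor_sub_tensor_le h₁ h₂ (fun x => c.norm_coe_le_norm x) hK').trans ?_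
    have h₃ : |K| * ∫ x, |f.1 x - c x| ∂μ ≤ η / 4 := by
      calc |K| * ∫ x, |f.1 x - c x| ∂μ ≤ (|K| + 1) * (η / (4 * (|K| + 1))) := by
            refine mul_le_mul (by linarith) hc (integral_nonneg fun _ => abs_nonneg _)
              (by positivity)
        _ = η / 4 := by field_simp
    have h₄ : ‖c‖ * ∫ z, |k.1 z - d z| ∂ν ≤ η / 4 := by
      calc ‖c‖ * ∫ z, |k.1 z - d z| ∂ν ≤ (‖c‖ + 1) * (η / (4 * (‖c‖ + 1))) := by
            refine mul_le_mul (by linarith) hd (integral_nonneg fun _ => abs_nonneg _)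
              (by positivity)
        _ = η / 4 := by field_simp
    exact (add_le_add h₃ h₄).trans_eq (by ring)
  have h₁ := hbound hΛ hΛfst hΛsnd
  have h₂ := hbound hΨ hΨfst hΨsnd
  rw [h (boundedMeasurableTensor c' d') ((c.continuous.comp continuous_fst).mul
    (d.continuous.comp continuous_snd))] at h₁
  rw [abs_le] at h₁ h₂ ⊢
  constructor <;> linarith

/-- A positive functional on bounded measurable functions of a compact space is represented, on
continuous functions, by a finite measure. -/
theorem IsPositiveFunctional.exists_measure {Λ : boundedMeasurable X →ₗ[ℝ] ℝ}
    (hΛ : IsPositiveFunctional Λ) :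
    ∃ (σ : Measure X) (_ : IsFiniteMeasure σ), ∀ u : boundedMeasurable X, Continuous u.1 →
      Λ u = ∫ x, u.1 x ∂σ := by
  let L : CompactlySupportedContinuousMap X ℝ →ₗ[ℝ] ℝ :=
    { toFun := fun g => Λ ⟨g, continuous_mem_boundedMeasurable g.continuous⟩
      map_add' := fun g g' => Λ.map_add ⟨g, continuous_mem_boundedMeasurable g.continuous⟩
        ⟨g', continuous_mem_boundedMeasurable g'.continuous⟩
      map_smul' := fun r g =>
        Λ.map_smul r ⟨g, continuous_mem_boundedMeasurable g.continuous⟩ }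
  let L' := PositiveLinearMap.mk₀ L fun g hg => hΛ _ hg
  refine ⟨RealRMK.rieszMeasure L', inferInstance, fun u hu => ?_⟩
  exact (RealRMK.integral_rieszMeasure L'
    (CompactlySupportedContinuousMap.continuousMapEquiv ⟨u.1, hu⟩)).symm

/-- A positive functional on bounded measurable functions on a product of compact metric spaces,
whose marginals are measures, is represented by a coupling on tensor products. -/
theorem IsPositiveFunctional.exists_coupling {Λ : boundedMeasurable (X × Z) →ₗ[ℝ] ℝ}
    (hΛ : IsPositiveFunctional Λ) {μ : Measure X} [IsFiniteMeasure μ] {ν : Measure Z}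
    [IsFiniteMeasure ν]
    (hfst : Λ ∘ₗ boundedMeasurableComp measurable_fst = boundedMeasurableIntegral μ)
    (hsnd : Λ ∘ₗ boundedMeasurableComp measurable_snd = boundedMeasurableIntegral ν) :
    ∃ (σ : Measure (X × Z)) (_ : IsFiniteMeasure σ), σ.fst = μ ∧
      ∀ f k, Λ (boundedMeasurableTensor f k) =
        ∫ p, (boundedMeasurableTensor f k).1 p ∂σ := by
  obtain ⟨σ, hσ, hσΛ⟩ := hΛ.exists_measure
  have hfst' : σ.fst = μ := by
    refine ext_of_forall_integral_eq_of_IsFiniteMeasure fun g => ?_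
    let g' : boundedMeasurable X := ⟨g, continuous_mem_boundedMeasurable g.continuous⟩
    have h₁ := LinearMap.congr_fun hfst g'
    have h₂ := hσΛ (boundedMeasurableComp measurable_fst g') (g.continuous.comp continuous_fst)
    rw [Measure.fst, integral_map measurable_fst.aemeasurable
      g.continuous.measurable.aestronglyMeasurable]
    exact h₂.symm.trans h₁
  have hsnd' : σ.snd = ν := by
    refine ext_of_forall_integral_eq_of_IsFiniteMeasure fun g => ?_
    let g' : boundedMeasurable Z := ⟨g, continuous_mem_boundedMeasurable g.continuous⟩
    have h₁ := LinearMap.congr_fun hsnd g'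
    have h₂ := hσΛ (boundedMeasurableComp measurable_snd g') (g.continuous.comp continuous_snd)
    rw [Measure.snd, integral_map measurable_snd.aemeasurable
      g.continuous.measurable.aestronglyMeasurable]
    exact h₂.symm.trans h₁
  refine ⟨σ, hσ, hfst', fun f k => hΛ.tensor_eq_of_continuous
    (isPositiveFunctional_boundedMeasurableIntegral σ) hfst hsnd ?_ ?_ hσΛ f k⟩
  · refine LinearMap.ext fun g => ?_
    subst hfst'
    exact (integral_map measurable_fst.aemeasurable g.2.1.aestronglyMeasurable).symm
  · refine LinearMap.ext fun g => ?_
    subst hsnd'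
    exact (integral_map measurable_snd.aemeasurable g.2.1.aestronglyMeasurable).symm

end Representation

section Comparison

variable {Ω X Z 𝒴 : Type*} [MeasurableSpace Ω] [MeasurableSpace X] [MeasurableSpace Z]
  [MeasurableSpace 𝒴]

/-- Every finite-valued reward attainable with the information state `S` is approximately
attainable with the information state `T`. -/
def ApproximatelyAttains (P : Measure Ω) (S : Ω → Z) (T : Ω → X) (Y : Ω → 𝒴) : Prop :=
  ∀ (h : SimpleFunc Z (boundedMeasurable 𝒴)) (ε : ℝ), 0 < ε →
    ∃ δ : SimpleFunc X (boundedMeasurable 𝒴), (∀ t, ∃ s, δ t = h s) ∧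
      ∫ ω, (h (S ω)).1 (Y ω) ∂P ≤ ∫ ω, (δ (T ω)).1 (Y ω) ∂P + ε

theorem integral_eq_integral_condDistrib [StandardBorelSpace 𝒴] [Nonempty 𝒴]
    (P : Measure Ω) [IsProbabilityMeasure P] {T : Ω → X} (hT : Measurable T)
    {Y : Ω → 𝒴} (hY : Measurable Y) {u : X × 𝒴 → ℝ} (hu : u ∈ boundedMeasurable (X × 𝒴)) :
    ∫ ω, u (T ω, Y ω) ∂P = ∫ ω, ∫ y, u (T ω, y) ∂condDistrib Y T P (T ω) ∂P := by
  have : IsProbabilityMeasure (P.map T) := Measure.isProbabilityMeasure_map hT.aemeasurable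
  rw [← integral_map (f := u) (hT.prodMk hY).aemeasurable hu.1.aestronglyMeasurable,
    ← compProd_map_condDistrib hY.aemeasurable,
    Measure.integral_compProd (integrable_of_mem_boundedMeasurable hu _)]
  exact integral_map hT.aemeasurable
    (kernel_integral_mem_boundedMeasurable _ hu).1.aestronglyMeasurable

theorem reward_mem_boundedMeasurable {S : Ω → Z} (hS : Measurable S) {Y : Ω → 𝒴}
    (hY : Measurable Y) (h : SimpleFunc Z (boundedMeasurable 𝒴)) :
    (fun ω => (h (S ω)).1 (Y ω)) ∈ boundedMeasurable Ω :=
  comp_mem_boundedMeasurable (simpleFunc_mem_boundedMeasurable h) (hS.prodMk hY)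

/-- The conditional expectation of a finite-valued reward under the kernel `κ`, as a function of the
conditioning value and of the action. -/
noncomputable def conditionalReward (κ : Kernel X 𝒴) (h : SimpleFunc Z (boundedMeasurable 𝒴)) :
    X × Z → ℝ :=
  fun w => ∫ y, (h w.2).1 y ∂κ w.1

theorem conditionalReward_mem_boundedMeasurable (κ : Kernel X 𝒴) [IsMarkovKernel κ]
    (h : SimpleFunc Z (boundedMeasurable 𝒴)) :
    conditionalReward κ h ∈ boundedMeasurable (X × Z) :=
  kernel_integral_mem_boundedMeasurable (κ.comap Prod.fst measurable_fst)
    (comp_mem_boundedMeasurable (simpleFunc_mem_boundedMeasurable h)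
      ((measurable_snd.comp measurable_fst).prodMk measurable_snd))

theorem integrable_kernel_of_mem_boundedMeasurable (κ : Kernel X 𝒴) [IsMarkovKernel κ]
    (g : boundedMeasurable 𝒴) (x : X) : Integrable g.1 (κ x) :=
  integrable_of_mem_boundedMeasurable g.2 _

/-- If `T` approximately attains every reward attainable with `S`, then there is a positive linear
functional on bounded functions of `(t, s)` which represents the law of `T` on functions of `t` and
the joint law of `(S, Y)` on conditional rewards. -/
theorem ApproximatelyAttains.exists_functional [StandardBorelSpace 𝒴] [Nonempty 𝒴]
    {P : Measure Ω} [IsProbabilityMeasure P] {S : Ω → Z} (hS : Measurable S)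
    {T : Ω → X} (hT : Measurable T) {Y : Ω → 𝒴} (hY : Measurable Y)
    (hdom : ApproximatelyAttains P S T Y) :
    ∃ Λ : boundedMeasurable (X × Z) →ₗ[ℝ] ℝ, IsPositiveFunctional Λ ∧
      Λ ∘ₗ boundedMeasurableComp measurable_fst = boundedMeasurableIntegral (P.map T) ∧
      ∀ h : SimpleFunc Z (boundedMeasurable 𝒴),
        Λ ⟨conditionalReward (condDistrib Y T P) h, conditionalReward_mem_boundedMeasurable _ h⟩ =
          ∫ ω, (h (S ω)).1 (Y ω) ∂P := by
  set κ := condDistrib Y T P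
  have hint := integrable_kernel_of_mem_boundedMeasurable κ
  let J₁ : SimpleFunc Z (boundedMeasurable 𝒴) →ₗ[ℝ] boundedMeasurable (X × Z) :=
    { toFun := fun h => ⟨conditionalReward κ h, conditionalReward_mem_boundedMeasurable κ h⟩
      map_add' := fun h k => Subtype.ext (funext fun w =>
        integral_add (hint (h w.2) w.1) (hint (k w.2) w.1))
      map_smul' := fun c h => Subtype.ext (funext fun w => integral_const_mul c _) }
  let J₂ : boundedMeasurable X →ₗ[ℝ] boundedMeasurable (X × Z) :=
    boundedMeasurableComp measurable_fst
  have hint₁ (h : SimpleFunc Z (boundedMeasurable 𝒴)) :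
      Integrable (fun ω => (h (S ω)).1 (Y ω)) P :=
    integrable_of_mem_boundedMeasurable (reward_mem_boundedMeasurable hS hY h) P
  have hint₂ (f : boundedMeasurable X) : Integrable (fun ω => f.1 (T ω)) P :=
    integrable_of_mem_boundedMeasurable (comp_mem_boundedMeasurable f.2 hT) P
  let p₁ : SimpleFunc Z (boundedMeasurable 𝒴) →ₗ[ℝ] ℝ :=
    { toFun := fun h => ∫ ω, (h (S ω)).1 (Y ω) ∂P
      map_add' := fun h k => integral_add (hint₁ h) (hint₁ k)
      map_smul' := fun c h => integral_const_mul c _ }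
  let p₂ : boundedMeasurable X →ₗ[ℝ] ℝ := boundedMeasurableIntegral (P.map T)
  have hpos : ∀ x, J₁.coprod J₂ x ∈ nonnegBoundedMeasurable (X × Z) → 0 ≤ p₁.coprod p₂ x := by
    rintro ⟨h, f⟩ hx
    have hx' : ∀ t s, 0 ≤ ∫ y, (h s).1 y ∂κ t + f.1 t := fun t s => hx (t, s)
    refine le_of_forall_pos_le_add fun ε hε => ?_
    obtain ⟨δ, hδ, hle⟩ := hdom (-h) ε hε
    have h₁ : ∫ ω, ((-h) (S ω)).1 (Y ω) ∂P = -∫ ω, (h (S ω)).1 (Y ω) ∂P :=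
      integral_neg _
    have h₂ : ∫ ω, (δ (T ω)).1 (Y ω) ∂P ≤ ∫ ω, f.1 (T ω) ∂P := by
      rw [integral_eq_integral_condDistrib P hT hY (simpleFunc_mem_boundedMeasurable δ)]
      refine integral_mono (integrable_of_mem_boundedMeasurable (comp_mem_boundedMeasurable
        (kernel_integral_mem_boundedMeasurable κ (simpleFunc_mem_boundedMeasurable δ)) hT) P)
        (hint₂ f) fun ω => ?_
      obtain ⟨s, hs⟩ := hδ (T ω)
      have h₃ : ∫ y, (δ (T ω)).1 y ∂κ (T ω) = -∫ y, (h s).1 y ∂κ (T ω) := by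
        rw [hs]
        exact integral_neg _
      have h₄ := hx' (T ω) s
      change ∫ y, (δ (T ω)).1 y ∂κ (T ω) ≤ f.1 (T ω)
      linarith
    change 0 ≤ ∫ ω, (h (S ω)).1 (Y ω) ∂P + ∫ t, f.1 t ∂P.map T + ε
    rw [integral_map hT.aemeasurable f.2.1.aestronglyMeasurable]
    linarith
  have hbound : ∀ u, ∃ x, J₁.coprod J₂ x + u ∈ nonnegBoundedMeasurable (X × Z) := by
    rintro ⟨u, hu, C, hC⟩
    refine ⟨(0, ⟨fun _ => C, const_mem_boundedMeasurable C⟩), fun w => ?_⟩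
    have h₁ : (J₁.coprod J₂ (0, ⟨fun _ => C, const_mem_boundedMeasurable C⟩)).1 w = C := by
      rw [LinearMap.coprod_apply, map_zero, zero_add]
      rfl
    change 0 ≤ (J₁.coprod J₂ (0, ⟨fun _ => C, const_mem_boundedMeasurable C⟩)).1 w + u w
    rw [h₁]
    linarith [neg_le_of_abs_le (hC w)]
  obtain ⟨Λ, hΛ, hΛpos⟩ := exists_positive_extension_of_map _ _ _ hpos hbound
  refine ⟨Λ, hΛpos, LinearMap.ext fun f => ?_, fun h => ?_⟩
  · have := hΛ (0, f)
    rw [LinearMap.coprod_apply, LinearMap.coprod_apply, map_zero, map_zero, zero_add,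
      zero_add] at this
    exact this
  · have := hΛ (h, 0)
    rw [LinearMap.coprod_apply, LinearMap.coprod_apply, map_zero, map_zero, add_zero,
      add_zero] at this
    exact this

/-- On compact metric spaces, approximate attainment of all finite-valued rewards yields a
garbling. -/
theorem ApproximatelyAttains.exists_kernel_of_compactSpace [MetricSpace X] [CompactSpace X]
    [BorelSpace X] [MetricSpace Z] [CompactSpace Z] [BorelSpace Z] [StandardBorelSpace Z]
    [Nonempty Z] [StandardBorelSpace 𝒴] [Nonempty 𝒴]
    {P : Measure Ω} [IsProbabilityMeasure P] {S : Ω → Z} (hS : Measurable S)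
    {T : Ω → X} (hT : Measurable T) {Y : Ω → 𝒴} (hY : Measurable Y)
    (hdom : ApproximatelyAttains P S T Y) :
    ∃ η : Kernel X Z, IsMarkovKernel η ∧ ∀ B C, MeasurableSet B → MeasurableSet C →
      P.real (S ⁻¹' C ∩ Y ⁻¹' B) = ∫ ω in Y ⁻¹' B, (η (T ω)).real C ∂P := by
  obtain ⟨Λ, hΛ, hfst, hreward⟩ := hdom.exists_functional hS hT hY
  have hsnd : Λ ∘ₗ boundedMeasurableComp measurable_snd =
      boundedMeasurableIntegral (P.map S) := by
    refine (hΛ.comp_boundedMeasurableComp measurable_snd).ext_simpleFunc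
      (isPositiveFunctional_boundedMeasurableIntegral _) fun k => ?_
    let h : SimpleFunc Z (boundedMeasurable 𝒴) :=
      k.map fun c => ⟨fun _ => c, const_mem_boundedMeasurable c⟩
    have h₁ : (⟨conditionalReward (condDistrib Y T P) h,
        conditionalReward_mem_boundedMeasurable _ h⟩ : boundedMeasurable (X × Z)) =
        boundedMeasurableComp measurable_snd (simpleFuncToBoundedMeasurable k) := by
      refine Subtype.ext (funext fun w => ?_)
      change ∫ _, k w.2 ∂condDistrib Y T P w.1 = k w.2
      simp
    rw [LinearMap.comp_apply, ← h₁, hreward]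
    exact (integral_map hS.aemeasurable k.measurable.aestronglyMeasurable).symm
  obtain ⟨σ, hσ, hσfst, htensor⟩ := hΛ.exists_coupling hfst hsnd
  refine ⟨σ.condKernel, inferInstance, fun B C hB hC => ?_⟩
  let b : boundedMeasurable 𝒴 := ⟨_, indicator_one_mem_boundedMeasurable hB⟩
  let k : boundedMeasurable Z := ⟨_, indicator_one_mem_boundedMeasurable hC⟩
  let f : boundedMeasurable X := ⟨fun t => ∫ y, b.1 y ∂condDistrib Y T P t,
    kernel_integral_mem_boundedMeasurable _ (comp_mem_boundedMeasurable b.2 measurable_snd)⟩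
  have hη : (fun t => ∫ s, k.1 s ∂σ.condKernel t) ∈ boundedMeasurable X :=
    kernel_integral_mem_boundedMeasurable _ (comp_mem_boundedMeasurable k.2 measurable_snd)
  let h : SimpleFunc Z (boundedMeasurable 𝒴) := (SimpleFunc.const Z b).piecewise C hC 0
  have h₁ : (⟨conditionalReward (condDistrib Y T P) h,
      conditionalReward_mem_boundedMeasurable _ h⟩ : boundedMeasurable (X × Z)) =
      boundedMeasurableTensor f k := by
    refine Subtype.ext (funext fun w => ?_)
    change ∫ y, (h w.2).1 y ∂condDistrib Y T P w.1 = f.1 w.1 * C.indicator 1 w.2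
    by_cases hw : w.2 ∈ C
    · simp [h, hw, f]
    · simp [h, hw]
  calc P.real (S ⁻¹' C ∩ Y ⁻¹' B)
      = ∫ ω, (h (S ω)).1 (Y ω) ∂P := by
        rw [← integral_indicator_one ((hS hC).inter (hY hB))]
        refine integral_congr_ae (Filter.Eventually.of_forall fun ω => ?_)
        by_cases hw : S ω ∈ C
        · by_cases hw' : Y ω ∈ B <;> simp [h, hw, hw', b]
        · simp [h, hw]
    _ = ∫ p, (boundedMeasurableTensor f k).1 p ∂(σ.fst ⊗ₘ σ.condKernel) := by
        rw [← hreward, h₁, htensor, Measure.disintegrate]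
    _ = ∫ t, f.1 t * ∫ s, k.1 s ∂σ.condKernel t ∂P.map T := by
        rw [Measure.integral_compProd (integrable_of_mem_boundedMeasurable
          (boundedMeasurableTensor f k).2 _), hσfst]
        exact integral_congr_ae (Filter.Eventually.of_forall fun t =>
          integral_const_mul (f.1 t) k.1)
    _ = ∫ ω, f.1 (T ω) * ∫ s, k.1 s ∂σ.condKernel (T ω) ∂P :=
        integral_map hT.aemeasurable (mul_mem_boundedMeasurable f.2 hη).1.aestronglyMeasurable
    _ = ∫ ω, b.1 (Y ω) * ∫ s, k.1 s ∂σ.condKernel (T ω) ∂P := by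
        rw [integral_eq_integral_condDistrib P hT hY (mul_mem_boundedMeasurable
          (comp_mem_boundedMeasurable b.2 measurable_snd)
          (comp_mem_boundedMeasurable hη measurable_fst))]
        exact integral_congr_ae (Filter.Eventually.of_forall fun ω =>
          (integral_mul_const _ _).symm)
    _ = ∫ ω in Y ⁻¹' B, (σ.condKernel (T ω)).real C ∂P := by
        rw [← integral_indicator (hY hB)]
        refine integral_congr_ae (Filter.Eventually.of_forall fun ω => ?_)
        by_cases hw : Y ω ∈ B <;> simp [hw, b, k, integral_indicator_one hC]

theorem exists_measurableEmbedding_unitInterval (α : Type*) [MeasurableSpace α]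
    [StandardBorelSpace α] : ∃ e : α → unitInterval, MeasurableEmbedding e := by
  have hℝ : ¬ Countable ℝ := Uncountable.not_countable
  have hI : ¬ Countable unitInterval := fun h => by
    have : Set.Icc (0 : ℝ) 1 |>.Countable := Set.countable_coe_iff.1 h
    exact (Cardinal.Real.Icc_countable_iff.1 this).not_gt zero_lt_one
  exact ⟨_, (PolishSpace.measurableEquivOfNotCountable hℝ hI).measurableEmbedding.comp
    (measurableEmbedding_embeddingReal α)⟩

theorem blackwellDominated_of_measureReal_eq {P : Measure Ω} [IsProbabilityMeasure P]
    {S : Ω → Z} (hS : Measurable S) {T : Ω → X} (hT : Measurable T) {Y : Ω → 𝒴}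
    (hY : Measurable Y) (η : Kernel X Z) [IsMarkovKernel η]
    (h : ∀ B C, MeasurableSet B → MeasurableSet C →
      P.real (S ⁻¹' C ∩ Y ⁻¹' B) = ∫ ω in Y ⁻¹' B, (η (T ω)).real C ∂P) :
    BlackwellDominated P S T Y := by
  refine ⟨η, inferInstance, ?_⟩
  have hkernel : (fun p : X × 𝒴 => (η p.1).map fun s => (s, p.2)) = η ∥ₖ Kernel.id := by
    ext1 p
    rw [Kernel.parallelComp_apply, Kernel.id_apply, Measure.prod_dirac]
  have : IsProbabilityMeasure (P.map fun ω => (S ω, Y ω)) :=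
    Measure.isProbabilityMeasure_map (hS.prodMk hY).aemeasurable
  refine Measure.ext_prod fun {C B} hC hB => ?_
  rw [hkernel, Measure.bind_apply (hC.prod hB) (Kernel.aemeasurable _),
    lintegral_map (Kernel.measurable_coe _ (hC.prod hB)) (hT.prodMk hY),
    Measure.map_apply (hS.prodMk hY) (hC.prod hB)]
  have hpre : (fun ω => (S ω, Y ω)) ⁻¹' C ×ˢ B = S ⁻¹' C ∩ Y ⁻¹' B := rfl
  have hη : Measurable fun ω => η (T ω) C := (Kernel.measurable_coe η hC).comp hT
  have hint : Integrable (fun ω => (η (T ω)).real C) (P.restrict (Y ⁻¹' B)) :=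
    Integrable.of_bound hη.ennreal_toReal.aestronglyMeasurable 1
      (Filter.Eventually.of_forall fun ω => by
        rw [Real.norm_of_nonneg measureReal_nonneg]
        exact measureReal_le_one)
  rw [hpre, ← ofReal_measureReal, h B C hB hC, ofReal_integral_eq_lintegral_ofReal hint
    (Filter.Eventually.of_forall fun _ => measureReal_nonneg), ← lintegral_indicator (hY hB)]
  refine lintegral_congr fun ω => ?_
  rw [Kernel.parallelComp_apply, Kernel.id_apply, Measure.prod_prod, Measure.dirac_apply' _ hB]
  by_cases hw : Y ω ∈ B <;> simp [hw, ofReal_measureReal]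

/-- On standard Borel spaces, approximate attainment of all finite-valued rewards implies
Blackwell domination. -/
theorem ApproximatelyAttains.blackwellDominated [StandardBorelSpace X] [StandardBorelSpace Z]
    [StandardBorelSpace 𝒴] [Nonempty 𝒴] {P : Measure Ω} [IsProbabilityMeasure P]
    {S : Ω → Z} (hS : Measurable S) {T : Ω → X} (hT : Measurable T) {Y : Ω → 𝒴}
    (hY : Measurable Y) (hdom : ApproximatelyAttains P S T Y) :
    BlackwellDominated P S T Y := by
  have : Nonempty Ω := nonempty_of_isProbabilityMeasure P
  obtain ⟨e, he⟩ := exists_measurableEmbedding_unitInterval X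
  obtain ⟨d, hd⟩ := exists_measurableEmbedding_unitInterval Z
  obtain ⟨e', he', hee'⟩ := he.exists_measurable_extend measurable_id fun _ => Nonempty.map T this
  obtain ⟨d', hd', hdd'⟩ := hd.exists_measurable_extend measurable_id fun _ => Nonempty.map S this
  have hdom' : ApproximatelyAttains P (fun ω => d (S ω)) (fun ω => e (T ω)) Y := by
    intro h ε hε
    obtain ⟨δ, hδ, hle⟩ := hdom (h.comp d hd.measurable) ε hε
    refine ⟨δ.comp e' he', fun t => ?_, ?_⟩
    · obtain ⟨s, hs⟩ := hδ (e' t)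
      exact ⟨d s, hs⟩
    · have this : ∀ ω, e' (e (T ω)) = T ω := fun ω => congr_fun hee' (T ω)
      simpa [this] using hle
  obtain ⟨η, hη, hrect⟩ := hdom'.exists_kernel_of_compactSpace (hd.measurable.comp hS)
    (he.measurable.comp hT) hY
  have : IsMarkovKernel (η.map d') := Kernel.IsMarkovKernel.map _ hd'
  refine blackwellDominated_of_measureReal_eq hS hT hY ((η.map d').comap e he.measurable)
    fun B C hB hC => ?_
  have hpre : (fun ω => d (S ω)) ⁻¹' (d' ⁻¹' C) = S ⁻¹' C := by
    ext ω
    have : d' (d (S ω)) = S ω := congr_fun hdd' (S ω)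
    simp [this]
  rw [← hpre]
  refine (hrect B _ hB (hd' hC)).trans ?_
  refine integral_congr_ae (Filter.Eventually.of_forall fun ω => ?_)
  change (η (e (T ω))).real (d' ⁻¹' C) = ((η.map d') (e (T ω))).real C
  rw [Kernel.map_apply _ hd', map_measureReal_apply hd' hC]

end Comparison

/-- A universally measurable decision rule into a finite set agrees almost surely with a
measurable one. -/
theorem exists_measurable_ae_eq_of_univCompletion {α A : Type*} [mα : MeasurableSpace α]
    [MeasurableSpace A] [MeasurableSpace.CountablyGenerated A] {δ : α → A}
    (hδ : Measurable[mα.univCompletion] δ) (μ : Measure α) [IsFiniteMeasure μ] :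
    ∃ δ' : α → A, Measurable δ' ∧ δ =ᵐ[μ] δ' :=
  NullMeasurable.aemeasurable fun _ hs => hδ hs μ inferInstance

theorem measurable_univCompletion {α A : Type*} [mα : MeasurableSpace α] [MeasurableSpace A]
    {δ : α → A} (hδ : Measurable δ) : Measurable[mα.univCompletion] δ :=
  fun _ hs _ _ => (hδ hs).nullMeasurableSet

theorem bayesRisk_le {Ω ℋ 𝒜 𝒴 : Type*} [MeasurableSpace Ω] [mℋ : MeasurableSpace ℋ]
    [MeasurableSpace 𝒜] [MeasurableSpace 𝒴] (P : Measure Ω) [IsProbabilityMeasure P]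
    (H : Ω → ℋ) (Y : Ω → 𝒴) {ℓ : 𝒜 → 𝒴 → ℝ} {C : ℝ} (hC : ∀ a y, |ℓ a y| ≤ C)
    {δ : ℋ → 𝒜} (hδ : Measurable δ) :
    BayesRisk mℋ P H Y ℓ ≤ ∫ ω, ℓ (δ (H ω)) (Y ω) ∂P := by
  refine ciInf_le (f := fun δ : {δ : ℋ → 𝒜 // Measurable[mℋ.univCompletion] δ} =>
    ∫ ω, ℓ (δ.1 (H ω)) (Y ω) ∂P) ⟨-C, ?_⟩ ⟨δ, measurable_univCompletion hδ⟩
  rintro _ ⟨δ, rfl⟩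
  have := norm_integral_le_of_norm_le_const (μ := P) (f := fun ω => ℓ (δ.1 (H ω)) (Y ω)) (C := C)
    (Filter.Eventually.of_forall fun ω => hC _ _)
  exact neg_le_of_abs_le (by simpa using this)

theorem exists_measurable_integral_le_bayesRisk_add {Ω ℋ 𝒜 𝒴 : Type*} [MeasurableSpace Ω]
    [mℋ : MeasurableSpace ℋ] [MeasurableSpace 𝒜] [MeasurableSpace.CountablyGenerated 𝒜]
    [Nonempty 𝒜] [MeasurableSpace 𝒴] (P : Measure Ω) [IsProbabilityMeasure P]
    {H : Ω → ℋ} (hH : Measurable H) (Y : Ω → 𝒴) (ℓ : 𝒜 → 𝒴 → ℝ) {ε : ℝ} (hε : 0 < ε) :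
    ∃ δ : ℋ → 𝒜, Measurable δ ∧
      ∫ ω, ℓ (δ (H ω)) (Y ω) ∂P ≤ BayesRisk mℋ P H Y ℓ + ε := by
  have : Nonempty {δ : ℋ → 𝒜 // Measurable[mℋ.univCompletion] δ} :=
    ⟨fun _ => Classical.arbitrary 𝒜, measurable_univCompletion measurable_const⟩
  obtain ⟨⟨δ, hδ⟩, hlt⟩ := exists_lt_of_ciInf_lt (lt_add_of_pos_right (BayesRisk mℋ P H Y ℓ) hε)
  obtain ⟨δ', hδ', hae⟩ := exists_measurable_ae_eq_of_univCompletion hδ (P.map H)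
  refine ⟨δ', hδ', le_of_eq_of_le (integral_congr_ae ?_) hlt.le⟩
  filter_upwards [ae_of_ae_map hH.aemeasurable hae] with ω hω
  rw [hω]

/-- Blackwell comparison, separation direction. If the information state `S`
is not Blackwell-dominated by `T` as an experiment about `Y`, then there exist a finite action
set `𝒜` and a bounded (measurable) loss `ℓ : 𝒜 × 𝒴 → ℝ` such that `V(S; ℓ) < V(T; ℓ)`. -/
theorem exists_loss_separating_of_not_blackwellDominated
    {Ω 𝒮 𝒯 𝒴 : Type*}
    [MeasurableSpace Ω]
    [m𝒮 : MeasurableSpace 𝒮] [StandardBorelSpace 𝒮]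
    [m𝒯 : MeasurableSpace 𝒯] [StandardBorelSpace 𝒯]
    [MeasurableSpace 𝒴] [StandardBorelSpace 𝒴] [Nonempty 𝒴]
    (P : Measure Ω) [IsProbabilityMeasure P]
    (Y : Ω → 𝒴) (hY : Measurable Y)
    (S : Ω → 𝒮) (hS : Measurable S)
    (T : Ω → 𝒯) (hT : Measurable T)
    (hnotdom : ¬ BlackwellDominated P S T Y) :
    ∃ (𝒜 : Type) (_ : Fintype 𝒜) (m𝒜 : MeasurableSpace 𝒜) (ℓ : 𝒜 → 𝒴 → ℝ),
      Measurable (Function.uncurry ℓ) ∧ (∃ C, ∀ a y, |ℓ a y| ≤ C) ∧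
      BayesRisk m𝒮 P S Y ℓ < BayesRisk m𝒯 P T Y ℓ := by
  by_contra hcon
  push Not at hcon
  refine hnotdom (ApproximatelyAttains.blackwellDominated hS hT hY fun h ε hε => ?_)
  have : Nonempty Ω := nonempty_of_isProbabilityMeasure P
  have : Nonempty 𝒮 := Nonempty.map S this
  have : Finite (Set.range h) := h.finite_range
  obtain ⟨n, ⟨i⟩⟩ := Finite.exists_equiv_fin (Set.range h)
  have : Nonempty (Fin n) := (inferInstance : Nonempty (Set.range h)).map i
  let g : Fin n → boundedMeasurable 𝒴 := fun a => (i.symm a).1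
  let ℓ : Fin n → 𝒴 → ℝ := fun a y => -(g a).1 y
  let π : SimpleFunc 𝒮 (Fin n) :=
    { toFun := fun s => i ⟨h s, s, rfl⟩
      measurableSet_fiber' := fun a => by
        convert h.measurableSet_fiber (g a) using 1
        ext s
        change i _ = a ↔ h s = (i.symm a).1
        rw [← Equiv.eq_symm_apply, Subtype.ext_iff]
      finite_range' := Set.toFinite _ }
  have hπ (s) : g (π s) = h s := by
    change (i.symm (i ⟨h s, s, rfl⟩)).1 = h s
    rw [Equiv.symm_apply_apply]
  have hℓm : Measurable (Function.uncurry ℓ) :=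
    measurable_from_prod_countable_right fun a => (g a).2.1.neg
  have hℓb : ∃ C, ∀ a y, |ℓ a y| ≤ C := by
    choose c hc using fun a => (g a).2.2
    obtain ⟨C, hC⟩ := Finite.exists_le c
    exact ⟨C, fun a y => (abs_neg _).trans_le ((hc a y).trans (hC a))⟩
  have hle := hcon (Fin n) inferInstance inferInstance ℓ hℓm hℓb
  obtain ⟨C, hC⟩ := hℓb
  have hS' := bayesRisk_le P S Y hC π.measurable
  obtain ⟨δ, hδ, hT'⟩ := exists_measurable_integral_le_bayesRisk_add P hT Y ℓ hε
  let δ' : SimpleFunc 𝒯 (Fin n) :=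
    { toFun := δ
      measurableSet_fiber' := fun a => hδ (measurableSet_singleton a)
      finite_range' := Set.toFinite _ }
  refine ⟨δ'.map g, fun t => ?_, ?_⟩
  · obtain ⟨s, hs⟩ := (i.symm (δ t)).2
    exact ⟨s, hs.symm⟩
  · have h₁ : ∫ ω, ℓ (π (S ω)) (Y ω) ∂P = -∫ ω, (h (S ω)).1 (Y ω) ∂P := by
      rw [← integral_neg]
      simp only [ℓ, hπ]
    have h₂ : ∫ ω, ℓ (δ (T ω)) (Y ω) ∂P = -∫ ω, (g (δ (T ω))).1 (Y ω) ∂P := integral_neg _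
    change _ ≤ ∫ ω, (g (δ (T ω))).1 (Y ω) ∂P + ε
    linarith
end

section
/- Assume 𝒴 is finite. Let H be an information state and M = μ(H,ζ) with ζ independent of Y conditionally on H. Then the expected Kullback–Leibler distortion equals the conditional mutual information: E[KL(π_H ‖ π_M)] = I(Y; H | M), so that under logarithmic loss the communication gap V(M; s_log) − V(H; s_log) equals I(Y; H | M). -/
open MeasureTheory ProbabilityTheory ENNReal

/-- The posterior of `Y` given the information state `H`, as a (version of the) vector of
conditional probabilities `π_H(y) = P(Y = y | H)`. -/
noncomputable def posterior {Ω ℋ 𝒴 : Type*} [MeasurableSpace Ω]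
    (mℋ : MeasurableSpace ℋ) (P : Measure Ω) (H : Ω → ℋ) (Y : Ω → 𝒴) : Ω → 𝒴 → ℝ :=
  fun ω y => (P[(Y ⁻¹' {y}).indicator (fun _ => (1 : ℝ)) | MeasurableSpace.comap H mℋ]) ω

/-- Bayes risk of the reporting problem with scoring rule `s` (action space: the probability
simplex `Δ(𝒴)`, represented as `stdSimplex ℝ 𝒴`): the infimum of the expected score over all
simplex-valued reports that are measurable with respect to the universal completion of the
σ-algebra on the value space of `H`. -/
noncomputable def ReportRisk {Ω ℋ 𝒴 : Type*} [Fintype 𝒴] [MeasurableSpace Ω]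
    (mℋ : MeasurableSpace ℋ) (P : Measure Ω) (H : Ω → ℋ) (Y : Ω → 𝒴)
    (s : (𝒴 → ℝ) → 𝒴 → ℝ≥0∞) : ℝ≥0∞ :=
  ⨅ q : {q : ℋ → 𝒴 → ℝ //
      Measurable[mℋ.univCompletion] q ∧ ∀ h, q h ∈ stdSimplex ℝ 𝒴},
    ∫⁻ ω, s (q.1 (H ω)) (Y ω) ∂P

/-- A scoring rule is proper if reporting the true distribution minimizes the expected score. -/
def ProperScore {𝒴 : Type*} [Fintype 𝒴] (s : (𝒴 → ℝ) → 𝒴 → ℝ≥0∞) : Prop :=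
  ∀ p ∈ stdSimplex ℝ 𝒴, ∀ q ∈ stdSimplex ℝ 𝒴,
    ∑ y, ENNReal.ofReal (p y) * s p y ≤ ∑ y, ENNReal.ofReal (p y) * s q y

/-- A scoring rule is strictly proper if it is proper and the expected score is minimized
only by the true distribution. -/
def StrictlyProperScore {𝒴 : Type*} [Fintype 𝒴] (s : (𝒴 → ℝ) → 𝒴 → ℝ≥0∞) : Prop :=
  ProperScore s ∧ ∀ p ∈ stdSimplex ℝ 𝒴, ∀ q ∈ stdSimplex ℝ 𝒴,
    (∑ y, ENNReal.ofReal (p y) * s p y = ∑ y, ENNReal.ofReal (p y) * s q y) → p = q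

/-- The pointwise divergence `D_s(p, q) = Σ_y p(y) (s(q, y) − s(p, y))` of a scoring rule,
as a (truncated) difference of the two expected scores. -/
noncomputable def scoreDiv {𝒴 : Type*} [Fintype 𝒴] (s : (𝒴 → ℝ) → 𝒴 → ℝ≥0∞)
    (p q : 𝒴 → ℝ) : ℝ≥0∞ :=
  (∑ y, ENNReal.ofReal (p y) * s q y) - (∑ y, ENNReal.ofReal (p y) * s p y)

open Classical in
/-- The logarithmic scoring rule `s_log(q, y) = −log q(y)`, interpreted as `+∞` when
`q(y) = 0`. -/
noncomputable def slog {𝒴 : Type*} : (𝒴 → ℝ) → 𝒴 → ℝ≥0∞ :=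
  fun q y => if q y = 0 then ⊤ else ENNReal.ofReal (-Real.log (q y))

open Classical in
/-- The Kullback–Leibler divergence `KL(p ‖ q) = Σ_y p(y) log (p(y) / q(y))` on a finite set,
interpreted as `+∞` when `p(y) > 0 = q(y)` for some `y`. -/
noncomputable def KLdiv {𝒴 : Type*} [Fintype 𝒴] (p q : 𝒴 → ℝ) : ℝ≥0∞ :=
  if ∃ y, p y ≠ 0 ∧ q y = 0 then ⊤
  else ENNReal.ofReal (∑ y, p y * Real.log (p y / q y))

namespace LogScore

section Pointwise

variable {𝒴 : Type*} [Fintype 𝒴]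

lemma sum_mul_log_div_nonneg {p q : 𝒴 → ℝ} (hp : p ∈ stdSimplex ℝ 𝒴) (hq : q ∈ stdSimplex ℝ 𝒴)
    (h : ∀ y, p y ≠ 0 → q y ≠ 0) : 0 ≤ ∑ y, p y * Real.log (p y / q y) := by
  have key : ∀ y, p y - q y ≤ p y * Real.log (p y / q y) := by
    intro y
    rcases eq_or_ne (p y) 0 with h0 | h0
    · simpa [h0] using hq.1 y
    · have hpy : 0 < p y := lt_of_le_of_ne (hp.1 y) h0.symm
      have hqy : 0 < q y := lt_of_le_of_ne (hq.1 y) (h y h0).symm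
      have h1 := mul_le_mul_of_nonneg_left
        (Real.one_sub_inv_le_log_of_pos (div_pos hpy hqy)) hpy.le
      have h2 : p y * (1 - (p y / q y)⁻¹) = p y - q y := by field_simp
      linarith
  calc (0 : ℝ) = ∑ y, (p y - q y) := by simp [hp.2, hq.2]
    _ ≤ _ := Finset.sum_le_sum fun y _ => key y

lemma ofReal_mul_slog {p q : 𝒴 → ℝ} (hp : p ∈ stdSimplex ℝ 𝒴) (y : 𝒴)
    (h : p y ≠ 0 → q y ≠ 0) :
    ENNReal.ofReal (p y) * slog q y = ENNReal.ofReal (p y * -Real.log (q y)) := by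
  rcases eq_or_ne (p y) 0 with h0 | h0
  · simp [h0]
  · rw [slog, if_neg (h h0), ENNReal.ofReal_mul (hp.1 y)]

lemma sum_ofReal_mul_slog {p q : 𝒴 → ℝ} (hp : p ∈ stdSimplex ℝ 𝒴) (hq : q ∈ stdSimplex ℝ 𝒴)
    (h : ∀ y, p y ≠ 0 → q y ≠ 0) :
    ∑ y, ENNReal.ofReal (p y) * slog q y = ENNReal.ofReal (∑ y, p y * -Real.log (q y)) := by
  rw [ENNReal.ofReal_sum_of_nonneg]
  · exact Finset.sum_congr rfl fun y _ => ofReal_mul_slog hp y (h y)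
  · intro y _
    have hle : q y ≤ 1 := (mem_Icc_of_mem_stdSimplex hq y).2
    exact mul_nonneg (hp.1 y) (neg_nonneg.2 (Real.log_nonpos (hq.1 y) hle))

/-- The cross-entropy is the sum of the entropy and the Kullback–Leibler divergence. -/
lemma sum_slog_eq_add_KLdiv {p q : 𝒴 → ℝ} (hp : p ∈ stdSimplex ℝ 𝒴)
    (hq : q ∈ stdSimplex ℝ 𝒴) :
    ∑ y, ENNReal.ofReal (p y) * slog q y
      = ∑ y, ENNReal.ofReal (p y) * slog p y + KLdiv p q := by
  by_cases hex : ∃ y, p y ≠ 0 ∧ q y = 0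
  · rw [KLdiv, if_pos hex, add_top]
    obtain ⟨y, hpy, hqy⟩ := hex
    refine ENNReal.sum_eq_top.2 ⟨y, Finset.mem_univ y, ?_⟩
    rw [slog, if_pos hqy, ENNReal.mul_top]
    simpa using lt_of_le_of_ne (hp.1 y) hpy.symm
  · rw [KLdiv, if_neg hex]
    push Not at hex
    rw [sum_ofReal_mul_slog hp hq hex, sum_ofReal_mul_slog hp hp fun _ => id,
      ← ENNReal.ofReal_add _ (sum_mul_log_div_nonneg hp hq hex), ← Finset.sum_add_distrib]
    · refine congrArg _ (Finset.sum_congr rfl fun y _ => ?_)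
      rcases eq_or_ne (p y) 0 with h0 | h0
      · simp [h0]
      · rw [Real.log_div h0 (hex y h0)]
        ring
    · refine Finset.sum_nonneg fun y _ => mul_nonneg (hp.1 y) (neg_nonneg.2 ?_)
      exact Real.log_nonpos (hp.1 y) (mem_Icc_of_mem_stdSimplex hp y).2

end Pointwise

lemma measurable_slog {𝒴 : Type*} (y : 𝒴) : Measurable fun q : 𝒴 → ℝ => slog q y := by
  unfold slog
  refine Measurable.ite (measurableSet_eq_fun (measurable_pi_apply y) measurable_const)
    measurable_const ?_
  fun_prop

section CondExp

variable {Ω : Type*} {m mΩ : MeasurableSpace Ω} {P : Measure Ω}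

lemma condExp_indicator_nonneg (s : Set Ω) : ∀ᵐ ω ∂P, 0 ≤ (P⟦s | m⟧) ω :=
  condExp_nonneg (ae_of_all _ fun _ => Set.indicator_nonneg (fun _ _ => zero_le_one) _)

lemma measurable_ofReal_condExp (f : Ω → ℝ) :
    Measurable[m] fun ω => ENNReal.ofReal ((P[f | m]) ω) :=
  ENNReal.measurable_ofReal.comp stronglyMeasurable_condExp.measurable

variable [IsFiniteMeasure P]

/-- Integrating an `m`-measurable function over an event weights it by the conditional
probability of the event given `m`. -/
lemma setLIntegral_eq_lintegral_condExp_mul (hm : m ≤ mΩ) {s : Set Ω} (hs : MeasurableSet s)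
    {f : Ω → ℝ≥0∞} (hf : Measurable[m] f) :
    ∫⁻ ω in s, f ω ∂P = ∫⁻ ω, ENNReal.ofReal ((P⟦s | m⟧) ω) * f ω ∂P := by
  have hd := (measurable_ofReal_condExp (P := P) (m := m) (s.indicator fun _ => 1)).mono hm le_rfl
  have htrim : (P.restrict s).trim hm
      = (P.withDensity fun ω => ENNReal.ofReal ((P⟦s | m⟧) ω)).trim hm := by
    refine @Measure.ext _ m _ _ fun t ht => ?_
    rw [trim_measurableSet_eq hm ht, trim_measurableSet_eq hm ht, withDensity_apply _ (hm t ht),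
      Measure.restrict_apply (hm t ht),
      ← ofReal_integral_eq_lintegral_ofReal integrable_condExp.integrableOn
        (ae_restrict_of_ae (condExp_indicator_nonneg s)),
      setIntegral_condExp hm ((integrable_const 1).indicator hs) ht,
      setIntegral_indicator hs, setIntegral_const, smul_eq_mul, mul_one, ofReal_measureReal]
  rw [← lintegral_trim hm hf, htrim, lintegral_trim hm hf,
    lintegral_withDensity_eq_lintegral_mul _ hd (hf.mono hm le_rfl)]
  rfl

/-- If `s` is conditionally independent of `Z` given `σ(X)`, then also observing `Z` does not
change the conditional probability of `s` given `X`. -/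
lemma condExp_prodMk_eq {𝒳 𝒵 : Type*} [m𝒳 : MeasurableSpace 𝒳] [MeasurableSpace 𝒵]
    {X : Ω → 𝒳} {Z : Ω → 𝒵} (hX : Measurable X) (hZ : Measurable Z) {s : Set Ω}
    (hs : MeasurableSet s)
    (hind : ∀ t, MeasurableSet t → P⟦Z ⁻¹' t ∩ s | m𝒳.comap X⟧
      =ᵐ[P] fun ω => (P⟦Z ⁻¹' t | m𝒳.comap X⟧) ω * (P⟦s | m𝒳.comap X⟧) ω) :
    P⟦s | m𝒳.comap X⟧
      =ᵐ[P] P⟦s | MeasurableSpace.comap (fun ω => (X ω, Z ω)) inferInstance⟧ := by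
  have hm : m𝒳.comap X ≤ mΩ := hX.comap_le
  have hXZ : Measurable fun ω => (X ω, Z ω) := hX.prodMk hZ
  have hle : m𝒳.comap X ≤ MeasurableSpace.comap (fun ω => (X ω, Z ω)) inferInstance := by
    rintro _ ⟨t, ht, rfl⟩
    exact ⟨Prod.fst ⁻¹' t, measurable_fst ht, rfl⟩
  have hd := measurable_ofReal_condExp (P := P) (m := m𝒳.comap X) (s.indicator fun _ => 1)
  have : IsFiniteMeasure (P.withDensity fun ω => ENNReal.ofReal ((P⟦s | m𝒳.comap X⟧) ω)) :=
    isFiniteMeasure_withDensity_ofReal integrable_condExp.2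
  have hmap : (P.withDensity fun ω => ENNReal.ofReal ((P⟦s | m𝒳.comap X⟧) ω)).map
        (fun ω => (X ω, Z ω))
      = (P.restrict s).map fun ω => (X ω, Z ω) := by
    refine Measure.ext_prod fun {a b} ha hb => ?_
    have hA : MeasurableSet[m𝒳.comap X] (X ⁻¹' a) := ⟨a, ha, rfl⟩
    have hB : MeasurableSet (Z ⁻¹' b) := hZ hb
    have hpre : (fun ω => (X ω, Z ω)) ⁻¹' (a ×ˢ b) = X ⁻¹' a ∩ Z ⁻¹' b := rfl
    rw [Measure.map_apply hXZ (ha.prod hb), Measure.map_apply hXZ (ha.prod hb), hpre,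
      withDensity_apply _ ((hm _ hA).inter hB), ← setLIntegral_indicator (hm _ hA),
      setLIntegral_eq_lintegral_condExp_mul hm hB (hd.indicator hA),
      Measure.restrict_apply ((hm _ hA).inter hB), Set.inter_assoc,
      ← setLIntegral_one, ← setLIntegral_indicator (hm _ hA),
      setLIntegral_eq_lintegral_condExp_mul hm (hB.inter hs) (measurable_const.indicator hA)]
    refine lintegral_congr_ae ?_
    filter_upwards [hind b hb, condExp_indicator_nonneg (P := P) (m := m𝒳.comap X) (Z ⁻¹' b)]
      with ω h1 h2
    by_cases hω : ω ∈ X ⁻¹' a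
    · rw [Set.indicator_of_mem hω, Set.indicator_of_mem hω, h1, ENNReal.ofReal_mul h2, mul_one]
    · rw [Set.indicator_of_notMem hω, Set.indicator_of_notMem hω, mul_zero, mul_zero]
  refine ae_eq_condExp_of_forall_setIntegral_eq hXZ.comap_le ((integrable_const 1).indicator hs)
    (fun _ _ _ => integrable_condExp.integrableOn) ?_
    (stronglyMeasurable_condExp.mono hle).aestronglyMeasurable
  rintro _ ⟨u, hu, rfl⟩ -
  have h := congrArg (fun ν => ν u) hmap
  simp only [Measure.map_apply hXZ hu, withDensity_apply _ (hXZ hu),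
    Measure.restrict_apply (hXZ hu)] at h
  rw [integral_eq_lintegral_of_nonneg_ae (ae_restrict_of_ae (condExp_indicator_nonneg s))
    (stronglyMeasurable_condExp.mono hm).aestronglyMeasurable, h, setIntegral_indicator hs,
    setIntegral_const, smul_eq_mul, mul_one, measureReal_def]

end CondExp

lemma aemeasurable_of_univCompletion {α β : Type*} [mα : MeasurableSpace α]
    [MeasurableSpace β] [MeasurableSpace.CountablyGenerated β] {q : α → β}
    (hq : Measurable[mα.univCompletion] q) (μ : Measure α) [IsFiniteMeasure μ] :
    AEMeasurable q μ :=
  NullMeasurable.aemeasurable fun _ hs => hq hs μ inferInstance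

lemma le_univCompletion {α : Type*} (m : MeasurableSpace α) : m ≤ m.univCompletion :=
  fun _ hs _ _ => hs.nullMeasurableSet

section Risk

variable {Ω ℋ 𝒴 : Type*} [mΩ : MeasurableSpace Ω] [mℋ : MeasurableSpace ℋ] {P : Measure Ω}
  {Y : Ω → 𝒴} {H : Ω → ℋ}

lemma measurable_posterior :
    Measurable[mℋ.comap H] (posterior mℋ P H Y) :=
  @measurable_pi_lambda _ _ _ (mℋ.comap H) _ _ fun _ => stronglyMeasurable_condExp.measurable

variable [IsProbabilityMeasure P] [Fintype 𝒴] [MeasurableSpace 𝒴] [DiscreteMeasurableSpace 𝒴]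

lemma posterior_mem_stdSimplex (hY : Measurable Y) (hH : Measurable H) :
    ∀ᵐ ω ∂P, posterior mℋ P H Y ω ∈ stdSimplex ℝ 𝒴 := by
  have hint : ∀ y ∈ Finset.univ, Integrable ((Y ⁻¹' {y}).indicator fun _ => (1 : ℝ)) P :=
    fun y _ => (integrable_const 1).indicator (hY (.singleton y))
  have hsum : ∑ y, ((Y ⁻¹' {y}).indicator fun _ => (1 : ℝ)) = fun _ => 1 := by
    classical
    ext ω
    simp [Set.indicator_apply]
  have h := condExp_finsetSum hint (mℋ.comap H)
  rw [hsum, condExp_const hH.comap_le] at h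
  filter_upwards [h, ae_all_iff.2 fun y => condExp_indicator_nonneg (P := P) (m := mℋ.comap H)
    (Y ⁻¹' {y})] with ω h1 h2
  refine ⟨h2, ?_⟩
  rw [Finset.sum_apply] at h1
  exact h1.symm

/-- The expectation of an `H`-measurable function of `Y` is computed by averaging over the
posterior. -/
lemma lintegral_eq_lintegral_sum_posterior (hY : Measurable Y) (hH : Measurable H)
    {f : Ω → 𝒴 → ℝ≥0∞} (hf : ∀ y, Measurable[mℋ.comap H] fun ω => f ω y) :
    ∫⁻ ω, f ω (Y ω) ∂P = ∫⁻ ω, ∑ y, ENNReal.ofReal (posterior mℋ P H Y ω y) * f ω y ∂P := by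
  classical
  have hsplit : ∀ ω, f ω (Y ω) = ∑ y, (Y ⁻¹' {y}).indicator (fun ω => f ω y) ω := by
    intro ω
    simp [Set.indicator_apply]
  have hf' := fun y => (hf y).mono hH.comap_le le_rfl
  simp_rw [hsplit]
  rw [lintegral_finsetSum _ fun y _ => (hf' y).indicator (hY (.singleton y)),
    lintegral_finsetSum]
  · refine Finset.sum_congr rfl fun y _ => ?_
    rw [lintegral_indicator (hY (.singleton y)),
      setLIntegral_eq_lintegral_condExp_mul hH.comap_le (hY (.singleton y)) (hf y)]
    rfl
  · exact fun y _ => ((measurable_ofReal_condExp _).mono hH.comap_le le_rfl).mul (hf' y)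

lemma lintegral_slog_posterior_le (hY : Measurable Y) (hH : Measurable H) {q : ℋ → 𝒴 → ℝ}
    (hq : Measurable[mℋ.univCompletion] q) (hq' : ∀ h, q h ∈ stdSimplex ℝ 𝒴) :
    ∫⁻ ω, slog (posterior mℋ P H Y ω) (Y ω) ∂P ≤ ∫⁻ ω, slog (q (H ω)) (Y ω) ∂P := by
  have : IsProbabilityMeasure (P.map H) := Measure.isProbabilityMeasure_map hH.aemeasurable
  have hae := aemeasurable_of_univCompletion hq (P.map H)
  have heq : ∀ᵐ ω ∂P, q (H ω) = hae.mk q (H ω) := ae_of_ae_map hH.aemeasurable hae.ae_eq_mk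
  have hmeas : Measurable[mℋ.comap H] fun ω => hae.mk q (H ω) :=
    hae.measurable_mk.comp (comap_measurable H)
  calc ∫⁻ ω, slog (posterior mℋ P H Y ω) (Y ω) ∂P
      = ∫⁻ ω, ∑ y, ENNReal.ofReal (posterior mℋ P H Y ω y)
          * slog (posterior mℋ P H Y ω) y ∂P :=
        lintegral_eq_lintegral_sum_posterior hY hH
          fun y => (measurable_slog y).comp measurable_posterior
    _ ≤ ∫⁻ ω, ∑ y, ENNReal.ofReal (posterior mℋ P H Y ω y) * slog (hae.mk q (H ω)) y ∂P := by
        refine lintegral_mono_ae ?_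
        filter_upwards [heq, posterior_mem_stdSimplex (P := P) hY hH] with ω h1 h2
        rw [← h1, sum_slog_eq_add_KLdiv h2 (hq' _)]
        exact le_self_add
    _ = ∫⁻ ω, slog (hae.mk q (H ω)) (Y ω) ∂P :=
        (lintegral_eq_lintegral_sum_posterior hY hH
          (f := fun ω => slog (hae.mk q (H ω))) fun y => (measurable_slog y).comp hmeas).symm
    _ = ∫⁻ ω, slog (q (H ω)) (Y ω) ∂P :=
        lintegral_congr_ae (heq.mono fun ω h => by simp only [h])

lemma exists_report_eq_posterior (hY : Measurable Y) (hH : Measurable H) :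
    ∃ q : ℋ → 𝒴 → ℝ, Measurable q ∧ (∀ h, q h ∈ stdSimplex ℝ 𝒴) ∧
      ∀ᵐ ω ∂P, q (H ω) = posterior mℋ P H Y ω := by
  classical
  obtain ⟨f, hf, hfH⟩ := (measurable_posterior (P := P) (H := H) (Y := Y)).exists_eq_measurable_comp
  obtain ⟨ω₀, hω₀⟩ := (posterior_mem_stdSimplex (P := P) hY hH).exists
  have hS : MeasurableSet (f ⁻¹' stdSimplex ℝ 𝒴) := hf (isClosed_stdSimplex ℝ 𝒴).measurableSet
  refine ⟨(f ⁻¹' stdSimplex ℝ 𝒴).piecewise f fun _ => posterior mℋ P H Y ω₀,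
    hf.piecewise hS measurable_const, fun h => ?_, ?_⟩
  · by_cases hh : h ∈ f ⁻¹' stdSimplex ℝ 𝒴
    · rwa [Set.piecewise_eq_of_mem _ _ _ hh]
    · rwa [Set.piecewise_eq_of_notMem _ _ _ hh]
  · filter_upwards [posterior_mem_stdSimplex (P := P) hY hH] with ω hω
    rw [hfH] at hω ⊢
    exact Set.piecewise_eq_of_mem _ _ _ hω

/-- Under the logarithmic score, reporting the posterior attains the Bayes risk. -/
lemma reportRisk_slog (hY : Measurable Y) (hH : Measurable H) :
    ReportRisk mℋ P H Y slog = ∫⁻ ω, slog (posterior mℋ P H Y ω) (Y ω) ∂P := by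
  refine le_antisymm ?_ (le_iInf fun q => lintegral_slog_posterior_le hY hH q.2.1 q.2.2)
  obtain ⟨q, hq, hq', hqH⟩ := exists_report_eq_posterior (P := P) hY hH
  refine (iInf_le _ ⟨q, hq.mono (le_univCompletion mℋ) le_rfl, hq'⟩).trans_eq ?_
  exact lintegral_congr_ae (hqH.mono fun ω h => by simp only [h])

end Risk

end LogScore

open LogScore Filter in
/-- expected KL distortion equals conditional mutual information. Assume
`𝒴` finite and `M = g(H, ζ)` with `ζ` conditionally independent of `Y` given `H`. Then
`E[KL(π_H ‖ π_M)] = I(Y; H | M)`, where, as in the text,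
`I(Y; H | M) = E[Σ_y P(Y=y | H,M) log (P(Y=y | H,M) / P(Y=y | M))]` is the expected KL
divergence between the posterior given `(H, M)` and the posterior given `M`. Consequently,
under finite expected log scores, the log-loss communication gap
`V(M; s_log) − V(H; s_log)` equals `I(Y; H | M)`. -/
theorem expected_KL_eq_condMutualInfo
    {Ω ℋ ℳ 𝒵 𝒴 : Type*}
    [MeasurableSpace Ω] [StandardBorelSpace Ω] [Nonempty Ω]
    [mℋ : MeasurableSpace ℋ] [StandardBorelSpace ℋ]
    [mℳ : MeasurableSpace ℳ] [StandardBorelSpace ℳ]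
    [MeasurableSpace 𝒵]
    [Fintype 𝒴] [MeasurableSpace 𝒴] [DiscreteMeasurableSpace 𝒴]
    (P : Measure Ω) [IsProbabilityMeasure P]
    (Y : Ω → 𝒴) (hY : Measurable Y)
    (H : Ω → ℋ) (hH : Measurable H)
    (ζ : Ω → 𝒵) (hζ : Measurable ζ)
    (g : ℋ × 𝒵 → ℳ) (hg : Measurable g)
    (M : Ω → ℳ) (hM : M = fun ω => g (H ω, ζ ω))
    (hindep : CondIndepFun (MeasurableSpace.comap H mℋ) hH.comap_le ζ Y P) :
    (∫⁻ ω, KLdiv (posterior mℋ P H Y ω) (posterior mℳ P M Y ω) ∂P =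
      ∫⁻ ω, KLdiv
        (posterior (inferInstance : MeasurableSpace (ℋ × ℳ)) P (fun ω' => (H ω', M ω')) Y ω)
        (posterior mℳ P M Y ω) ∂P) ∧
    ((∫⁻ ω, slog (posterior mℋ P H Y ω) (Y ω) ∂P ≠ ⊤) →
      (∫⁻ ω, slog (posterior mℳ P M Y ω) (Y ω) ∂P ≠ ⊤) →
      ReportRisk mℳ P M Y slog - ReportRisk mℋ P H Y slog =
        ∫⁻ ω, KLdiv
          (posterior (inferInstance : MeasurableSpace (ℋ × ℳ)) P (fun ω' => (H ω', M ω')) Y ω)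
          (posterior mℳ P M Y ω) ∂P) := by
  have hMm : Measurable M := hM ▸ hg.comp (hH.prodMk hζ)
  have hHM : Measurable fun ω => (H ω, M ω) := hH.prodMk hMm
  have hM_le : mℳ.comap M ≤ MeasurableSpace.comap (fun ω => (H ω, M ω)) inferInstance := by
    rintro _ ⟨t, ht, rfl⟩
    exact ⟨Prod.snd ⁻¹' t, measurable_snd ht, rfl⟩
  have hH_le : mℋ.comap H ≤ MeasurableSpace.comap (fun ω => (H ω, M ω)) inferInstance := by
    rintro _ ⟨t, ht, rfl⟩
    exact ⟨Prod.fst ⁻¹' t, measurable_fst ht, rfl⟩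
  have hHM_le : MeasurableSpace.comap (fun ω => (H ω, M ω)) inferInstance
      ≤ MeasurableSpace.comap (fun ω => (H ω, ζ ω)) inferInstance := by
    rintro _ ⟨t, ht, rfl⟩
    refine ⟨(fun z : ℋ × 𝒵 => (z.1, g z)) ⁻¹' t, (measurable_fst.prodMk hg) ht, ?_⟩
    rw [hM]
    rfl
  have hpost : ∀ᵐ ω ∂P, posterior mℋ P H Y ω
      = posterior (inferInstance : MeasurableSpace (ℋ × ℳ)) P (fun ω' => (H ω', M ω')) Y ω := by
    have hy : ∀ y, P⟦Y ⁻¹' {y} | mℋ.comap H⟧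
        =ᵐ[P] P⟦Y ⁻¹' {y} | MeasurableSpace.comap (fun ω => (H ω, M ω)) inferInstance⟧ := by
      intro y
      have hHζ := condExp_prodMk_eq (P := P) hH hζ (hY (.singleton y))
        fun t ht => (condIndepFun_iff_condExp_inter_preimage_eq_mul hζ hY).1 hindep t {y} ht
          (.singleton y)
      have htower := condExp_condExp_of_le (μ := P) (f := (Y ⁻¹' {y}).indicator fun _ => (1 : ℝ))
        hHM_le (hH.prodMk hζ).comap_le
      refine EventuallyEq.trans ?_ ((condExp_congr_ae hHζ).trans htower)
      rw [condExp_of_stronglyMeasurable hHM.comap_le (stronglyMeasurable_condExp.mono hH_le)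
        integrable_condExp]
    filter_upwards [ae_all_iff.2 hy] with ω h
    exact funext h
  refine ⟨lintegral_congr_ae (hpost.mono fun ω h => by simp only [h]), fun hfin _ => ?_⟩
  have hrisk : ReportRisk mℳ P M Y slog = ReportRisk mℋ P H Y slog
      + ∫⁻ ω, KLdiv
          (posterior (inferInstance : MeasurableSpace (ℋ × ℳ)) P (fun ω' => (H ω', M ω')) Y ω)
          (posterior mℳ P M Y ω) ∂P := by
    have hslogH : ∀ y, Measurable[MeasurableSpace.comap (fun ω => (H ω, M ω)) inferInstance]
        fun ω => slog (posterior mℋ P H Y ω) y :=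
      fun y => (measurable_slog y).comp (measurable_posterior.mono hH_le le_rfl)
    have hslogM : ∀ y, Measurable[MeasurableSpace.comap (fun ω => (H ω, M ω)) inferInstance]
        fun ω => slog (posterior mℳ P M Y ω) y :=
      fun y => (measurable_slog y).comp (measurable_posterior.mono hM_le le_rfl)
    rw [reportRisk_slog hY hMm, reportRisk_slog hY hH,
      lintegral_eq_lintegral_sum_posterior hY hHM (f := fun ω => slog (posterior mℳ P M Y ω)) hslogM,
      lintegral_eq_lintegral_sum_posterior hY hHM (f := fun ω => slog (posterior mℋ P H Y ω)) hslogH, ← lintegral_add_left]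
    · refine lintegral_congr_ae ?_
      filter_upwards [hpost, posterior_mem_stdSimplex (P := P) hY hHM,
        posterior_mem_stdSimplex (P := P) hY hMm] with ω h1 h2 h3
      rw [h1]
      exact sum_slog_eq_add_KLdiv h2 h3
    · exact Finset.measurable_sum _ fun y _ =>
        ((measurable_ofReal_condExp _).mul (hslogH y)).mono hHM.comap_le le_rfl
  rw [reportRisk_slog hY hH] at hrisk ⊢
  rw [hrisk, ENNReal.add_sub_cancel_left hfin]
end

section
/- Assume 𝒴 is finite. Let H be an information state and M = μ(H,ζ) with ζ independent of Y conditionally on H. Then under the multiclass Brier score, the communication gap equals the expected squared posterior error: V(M; s_Br) − V(H; s_Br) = E[‖π_H − π_M‖₂²]. -/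
open MeasureTheory ProbabilityTheory ENNReal

open Classical in
/-- The multiclass Brier score `s_Br(q, y) = Σ_{y'} (q(y') − 1{y' = y})²`. -/
noncomputable def sBrier {𝒴 : Type*} [Fintype 𝒴] : (𝒴 → ℝ) → 𝒴 → ℝ≥0∞ :=
  fun q y => ENNReal.ofReal (∑ y', (q y' - if y' = y then 1 else 0) ^ 2)

namespace BrierGap

section Orthogonality

variable {Ω : Type*} {m m₀ : MeasurableSpace Ω} {P : Measure Ω} [IsProbabilityMeasure P]

/-- The conditional expectation is the orthogonal projection: the mean squared error of a
bounded `m`-measurable predictor splits into its distance to the conditional expectation and the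
error of the conditional expectation. -/
lemma integral_sq_sub_eq_add_condExp (hm : m ≤ m₀) {f X : Ω → ℝ} {C : ℝ}
    (hf : AEStronglyMeasurable[m] f P) (hfb : ∀ᵐ ω ∂P, |f ω| ≤ C)
    (hX : Measurable[m₀] X) (hXb : ∀ ω, |X ω| ≤ C) :
    ∫ ω, (f ω - X ω) ^ 2 ∂P =
      ∫ ω, (f ω - (P[X | m]) ω) ^ 2 ∂P + ∫ ω, ((P[X | m]) ω - X ω) ^ 2 ∂P := by
  have hXi : Integrable X P := .of_bound hX.aestronglyMeasurable C (.of_forall hXb)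
  have hπb : ∀ᵐ ω ∂P, |(P[X | m]) ω| ≤ C :=
    ae_bdd_abs_condExp_of_ae_bdd_abs (.of_forall hXb)
  have hdm : AEStronglyMeasurable[m] (fun ω => f ω - (P[X | m]) ω) P :=
    hf.sub stronglyMeasurable_condExp.aestronglyMeasurable
  have hdb : ∀ᵐ ω ∂P, ‖f ω - (P[X | m]) ω‖ ≤ C + C := by
    filter_upwards [hfb, hπb] with ω h1 h2
    exact (norm_sub_le _ _).trans (add_le_add h1 h2)
  have heb : ∀ᵐ ω ∂P, ‖(P[X | m]) ω - X ω‖ ≤ C + C := by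
    filter_upwards [hπb] with ω h1
    exact (norm_sub_le _ _).trans (add_le_add h1 (hXb ω))
  have hei : Integrable (fun ω => (P[X | m]) ω - X ω) P := integrable_condExp.sub hXi
  have hd : MemLp (fun ω => f ω - (P[X | m]) ω) 2 P := .of_bound (hdm.mono hm) _ hdb
  have he : MemLp (fun ω => (P[X | m]) ω - X ω) 2 P := .of_bound hei.aestronglyMeasurable _ heb
  have hde : Integrable (fun ω => (f ω - (P[X | m]) ω) * ((P[X | m]) ω - X ω)) P :=
    hd.integrable_mul he
  have hcross : ∫ ω, (f ω - (P[X | m]) ω) * ((P[X | m]) ω - X ω) ∂P = 0 := by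
    rw [← integral_condExp hm]
    have hzero : P[fun ω => (P[X | m]) ω - X ω | m] =ᵐ[P] 0 := by
      refine (condExp_sub integrable_condExp hXi m).trans ?_
      rw [condExp_of_stronglyMeasurable hm stronglyMeasurable_condExp integrable_condExp, sub_self]
    have hpull := condExp_mul_of_aestronglyMeasurable_left hdm hde hei
    refine integral_eq_zero_of_ae ?_
    filter_upwards [hpull, hzero] with ω h1 h2
    exact h1.trans (by simp [h2])
  calc ∫ ω, (f ω - X ω) ^ 2 ∂P
      = ∫ ω, ((f ω - (P[X | m]) ω) ^ 2 + ((P[X | m]) ω - X ω) ^ 2)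
          + 2 * ((f ω - (P[X | m]) ω) * ((P[X | m]) ω - X ω)) ∂P := by
        congr 1 with ω; ring
    _ = _ := by
        have hsq : Integrable
            (fun ω => (f ω - (P[X | m]) ω) ^ 2 + ((P[X | m]) ω - X ω) ^ 2) P :=
          hd.integrable_sq.add he.integrable_sq
        rw [integral_add hsq (hde.const_mul 2), integral_add hd.integrable_sq he.integrable_sq,
          integral_const_mul, hcross]
        ring

end Orthogonality

section ConditionalIndependence

variable {Ω ℋ 𝒵 𝒴 : Type*} [MeasurableSpace Ω] [StandardBorelSpace Ω]
  [mℋ : MeasurableSpace ℋ] [MeasurableSpace 𝒵] [MeasurableSpace 𝒴]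
  {P : Measure Ω} [IsProbabilityMeasure P]

/-- If `ζ` and `Y` are conditionally independent given `H`, then adjoining `ζ` to `H` does not
change the conditional probabilities of `Y`. -/
lemma condExp_comap_prodMk_of_condIndepFun {Y : Ω → 𝒴} (hY : Measurable Y)
    {H : Ω → ℋ} (hH : Measurable H) {ζ : Ω → 𝒵} (hζ : Measurable ζ)
    (hindep : CondIndepFun (MeasurableSpace.comap H mℋ) hH.comap_le ζ Y P)
    {t : Set 𝒴} (ht : MeasurableSet t) :
    P[(Y ⁻¹' t).indicator (fun _ => (1 : ℝ)) | MeasurableSpace.comap H mℋ] =ᵐ[P]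
      P[(Y ⁻¹' t).indicator (fun _ => (1 : ℝ)) |
        MeasurableSpace.comap (fun ω => (H ω, ζ ω)) Prod.instMeasurableSpace] := by
  set X : Ω → ℝ := (Y ⁻¹' t).indicator (fun _ => (1 : ℝ)) with hX
  set π : Ω → ℝ := P[X | MeasurableSpace.comap H mℋ] with hπ
  have hK : Measurable (fun ω => (H ω, ζ ω)) := hH.prodMk hζ
  have hXi : Integrable X P := (integrable_const 1).indicator (hY ht)
  have hπi : Integrable π P := integrable_condExp
  have hle : MeasurableSpace.comap H mℋ ≤
      MeasurableSpace.comap (fun ω => (H ω, ζ ω)) Prod.instMeasurableSpace := by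
    rintro _ ⟨u, hu, rfl⟩
    exact ⟨Prod.fst ⁻¹' u, measurable_fst hu, rfl⟩
  refine ae_eq_condExp_of_forall_setIntegral_eq hK.comap_le hXi
    (fun s _ _ => hπi.integrableOn) ?_
    (stronglyMeasurable_condExp.mono hle).aestronglyMeasurable
  rintro _ ⟨s, hs, rfl⟩ -
  induction s, hs using MeasurableSpace.induction_on_inter generateFrom_prod.symm isPiSystem_prod
    with
  | empty => simp
  | basic s hs =>
    obtain ⟨u, hu, v, hv, rfl⟩ := hs
    have hA : MeasurableSet[MeasurableSpace.comap H mℋ] (H ⁻¹' u) := ⟨u, hu, rfl⟩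
    have hB : MeasurableSet (ζ ⁻¹' v) := hζ hv
    have key : ∀ f : Ω → ℝ, ∫ ω in (fun ω => (H ω, ζ ω)) ⁻¹' u ×ˢ v, f ω ∂P =
        ∫ ω in H ⁻¹' u, (ζ ⁻¹' v).indicator f ω ∂P := fun f => by
      rw [setIntegral_indicator hB]; rfl
    have hBi : Integrable ((ζ ⁻¹' v).indicator (fun _ => (1 : ℝ))) P :=
      (integrable_const 1).indicator hB
    have hmul : ∀ f : Ω → ℝ, (ζ ⁻¹' v).indicator f =
        (ζ ⁻¹' v).indicator (fun _ => (1 : ℝ)) * f := fun f => by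
      ext ω; by_cases h : ω ∈ ζ ⁻¹' v <;> simp [h]
    have hci := (condIndepFun_iff_condExp_inter_preimage_eq_mul hζ hY).1 hindep v t hv ht
    have h1 : P[(ζ ⁻¹' v).indicator π | MeasurableSpace.comap H mℋ] =ᵐ[P]
        P[(ζ ⁻¹' v).indicator (fun _ => (1 : ℝ)) | MeasurableSpace.comap H mℋ] * π := by
      rw [hmul]
      exact condExp_mul_of_stronglyMeasurable_right stronglyMeasurable_condExp
        (hmul π ▸ hπi.indicator hB) hBi
    have h2 : P[(ζ ⁻¹' v).indicator X | MeasurableSpace.comap H mℋ] =ᵐ[P]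
        P[(ζ ⁻¹' v).indicator (fun _ => (1 : ℝ)) | MeasurableSpace.comap H mℋ] * π := by
      rw [hX, Set.indicator_indicator]
      exact hci
    rw [key, key, ← setIntegral_condExp hH.comap_le (hπi.indicator hB) hA,
      ← setIntegral_condExp hH.comap_le (hXi.indicator hB) hA]
    exact integral_congr_ae (ae_restrict_of_ae (h1.trans h2.symm))
  | compl s hs ih =>
    have h1 := integral_add_compl (hK hs) hπi
    have h2 := integral_add_compl (hK hs) hXi
    have h3 : ∫ ω, π ω ∂P = ∫ ω, X ω ∂P := integral_condExp hH.comap_le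
    rw [Set.preimage_compl]
    linarith
  | iUnion s hd hs ih =>
    have hd' : Pairwise (Function.onFun Disjoint fun i => (fun ω => (H ω, ζ ω)) ⁻¹' s i) :=
      fun i j hij => (hd hij).preimage _
    rw [Set.preimage_iUnion,
      integral_iUnion (fun i => hK (hs i)) hd' hπi.integrableOn,
      integral_iUnion (fun i => hK (hs i)) hd' hXi.integrableOn]
    exact tsum_congr ih

end ConditionalIndependence

section ReportRisk

lemma le_univCompletion {α : Type*} (m : MeasurableSpace α) : m ≤ m.univCompletion :=
  fun _ hs _ _ => hs.nullMeasurableSet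

lemma aemeasurable_of_measurable_univCompletion {α β : Type*} [m : MeasurableSpace α]
    [MeasurableSpace β] [MeasurableSpace.CountablyGenerated β] [Nonempty β] {q : α → β}
    (hq : Measurable[m.univCompletion] q) (μ : Measure α) [IsFiniteMeasure μ] :
    AEMeasurable q μ :=
  NullMeasurable.aemeasurable fun _ hs => hq hs μ inferInstance

lemma abs_le_one_of_mem_stdSimplex {ι : Type*} [Fintype ι] {p : ι → ℝ}
    (hp : p ∈ stdSimplex ℝ ι) (i : ι) : |p i| ≤ 1 := by
  rw [abs_of_nonneg (hp.1 i), ← hp.2]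
  exact Finset.single_le_sum (fun j _ => hp.1 j) (Finset.mem_univ i)

variable {Ω ℋ 𝒴 : Type*} {Y : Ω → 𝒴} {H : Ω → ℋ}

lemma abs_indicator_preimage_le_one (y : 𝒴) (ω : Ω) :
    |(Y ⁻¹' {y}).indicator (fun _ => (1 : ℝ)) ω| ≤ 1 := by
  by_cases h : ω ∈ Y ⁻¹' {y} <;> simp [h]

lemma sBrier_eq [Fintype 𝒴] (q : 𝒴 → ℝ) (ω : Ω) : sBrier q (Y ω) =
    ENNReal.ofReal (∑ y, (q y - (Y ⁻¹' {y}).indicator (fun _ => (1 : ℝ)) ω) ^ 2) := by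
  classical
  simp [sBrier, Set.indicator_apply, eq_comm]

variable [MeasurableSpace Ω] [mℋ : MeasurableSpace ℋ] {P : Measure Ω}

lemma ae_abs_posterior_le_one (y : 𝒴) : ∀ᵐ ω ∂P, |posterior mℋ P H Y ω y| ≤ 1 :=
  ae_bdd_abs_condExp_of_ae_bdd_abs (.of_forall (abs_indicator_preimage_le_one y))

lemma stronglyMeasurable_posterior (y : 𝒴) :
    StronglyMeasurable[MeasurableSpace.comap H mℋ] (fun ω => posterior mℋ P H Y ω y) :=
  stronglyMeasurable_condExp

lemma lintegral_ofReal_sum_sq_sub [Fintype 𝒴] [IsProbabilityMeasure P]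
    {f g : 𝒴 → Ω → ℝ} {C : ℝ}
    (hf : ∀ y, AEStronglyMeasurable (f y) P) (hg : ∀ y, AEStronglyMeasurable (g y) P)
    (hfb : ∀ y, ∀ᵐ ω ∂P, |f y ω| ≤ C) (hgb : ∀ y, ∀ᵐ ω ∂P, |g y ω| ≤ C) :
    ∫⁻ ω, ENNReal.ofReal (∑ y, (f y ω - g y ω) ^ 2) ∂P =
      ENNReal.ofReal (∑ y, ∫ ω, (f y ω - g y ω) ^ 2 ∂P) := by
  have hi : ∀ y, Integrable (fun ω => (f y ω - g y ω) ^ 2) P := fun y =>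
    MemLp.integrable_sq (.of_bound ((hf y).sub (hg y)) (C + C) (by
      filter_upwards [hfb y, hgb y] with ω h1 h2
      exact (norm_sub_le _ _).trans (add_le_add h1 h2)))
  rw [← integral_finsetSum _ fun y _ => hi y, ofReal_integral_eq_lintegral_ofReal
    (integrable_finsetSum _ fun y _ => hi y)
    (.of_forall fun ω => Finset.sum_nonneg fun y _ => sq_nonneg _)]

variable [MeasurableSpace 𝒴] [DiscreteMeasurableSpace 𝒴]

lemma measurable_indicator_preimage (hY : Measurable Y) (y : 𝒴) :
    Measurable ((Y ⁻¹' {y}).indicator (fun _ => (1 : ℝ))) :=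
  measurable_const.indicator (hY (MeasurableSet.of_discrete))

variable [Fintype 𝒴] [IsProbabilityMeasure P]

lemma ae_posterior_mem_stdSimplex (hY : Measurable Y) (hH : Measurable H) :
    ∀ᵐ ω ∂P, posterior mℋ P H Y ω ∈ stdSimplex ℝ 𝒴 := by
  have hi : ∀ y, Integrable ((Y ⁻¹' {y}).indicator (fun _ => (1 : ℝ))) P := fun y =>
    (integrable_const 1).indicator (hY MeasurableSet.of_discrete)
  have hnonneg : ∀ᵐ ω ∂P, ∀ y, 0 ≤ posterior mℋ P H Y ω y :=
    ae_all_iff.2 fun y => condExp_nonneg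
      (.of_forall fun ω => Set.indicator_nonneg (fun _ _ => zero_le_one) ω)
  have hone : ∑ y, (Y ⁻¹' {y}).indicator (fun _ => (1 : ℝ)) = fun _ => 1 := by
    classical
    ext ω
    simp [Finset.sum_apply, Set.indicator_apply]
  have hsum := condExp_finsetSum (s := Finset.univ) (μ := P) (fun y _ => hi y)
    (MeasurableSpace.comap H mℋ)
  rw [hone, condExp_const hH.comap_le] at hsum
  filter_upwards [hnonneg, hsum] with ω h0 h1
  refine ⟨h0, ?_⟩
  rw [Finset.sum_apply] at h1
  exact h1.symm

/-- There is a simplex-valued measurable report attaining the posterior almost surely. -/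
lemma exists_measurable_report_ae_eq_posterior (hY : Measurable Y) (hH : Measurable H) :
    ∃ q : ℋ → 𝒴 → ℝ, Measurable q ∧ (∀ h, q h ∈ stdSimplex ℝ 𝒴) ∧
      ∀ᵐ ω ∂P, q (H ω) = posterior mℋ P H Y ω := by
  classical
  have hfac : ∀ y, ∃ p : ℋ → ℝ, StronglyMeasurable p ∧
      (fun ω => posterior mℋ P H Y ω y) = p ∘ H := fun y =>
    (stronglyMeasurable_posterior y).exists_eq_measurable_comp
  choose p hpm hp using hfac
  have hpm' : Measurable fun h y => p y h := measurable_pi_lambda _ fun y => (hpm y).measurable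
  have hmem := ae_posterior_mem_stdSimplex (P := P) hY hH
  obtain ⟨ω₀, h₀⟩ := hmem.exists
  refine ⟨fun h => if (fun y => p y h) ∈ stdSimplex ℝ 𝒴 then fun y => p y h
    else posterior mℋ P H Y ω₀, ?_, fun h => ?_, ?_⟩
  · exact Measurable.ite (hpm' (isClosed_stdSimplex ℝ 𝒴).measurableSet) hpm' measurable_const
  · dsimp only
    split_ifs with h
    exacts [h, h₀]
  · filter_upwards [hmem] with ω hω
    have heq : (fun y => p y (H ω)) = posterior mℋ P H Y ω :=
      funext fun y => (congrFun (hp y) ω).symm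
    simp only [heq, if_pos hω]

/-- The Bayes risk under the Brier score is the mean squared error of the posterior. -/
theorem reportRisk_sBrier (hY : Measurable Y) (hH : Measurable H) :
    ReportRisk mℋ P H Y sBrier = ENNReal.ofReal (∑ y, ∫ ω,
      (posterior mℋ P H Y ω y - (Y ⁻¹' {y}).indicator (fun _ => (1 : ℝ)) ω) ^ 2 ∂P) := by
  have hXm := fun y => (measurable_indicator_preimage hY y).aestronglyMeasurable (μ := P)
  have hXb : ∀ y, ∀ᵐ ω ∂P, |(Y ⁻¹' {y}).indicator (fun _ => (1 : ℝ)) ω| ≤ 1 := fun y =>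
    .of_forall (abs_indicator_preimage_le_one y)
  refine le_antisymm ?_ (le_iInf ?_)
  · obtain ⟨q, hqm, hqs, hq⟩ := exists_measurable_report_ae_eq_posterior (P := P) hY hH
    refine (iInf_le _ ⟨q, hqm.mono (le_univCompletion mℋ) le_rfl, hqs⟩).trans_eq ?_
    rw [← lintegral_ofReal_sum_sq_sub
      (fun y => ((stronglyMeasurable_posterior y).mono hH.comap_le).aestronglyMeasurable) hXm
      (fun y => ae_abs_posterior_le_one y) hXb]
    refine lintegral_congr_ae ?_
    filter_upwards [hq] with ω hω
    rw [sBrier_eq, hω]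
  · rintro ⟨q, hqm, hqs⟩
    have hqa : ∀ y, AEStronglyMeasurable[MeasurableSpace.comap H mℋ] (fun ω => q (H ω) y) P := by
      intro y
      have : IsProbabilityMeasure (P.map H) := Measure.isProbabilityMeasure_map hH.aemeasurable
      have hqy : AEMeasurable (fun h => q h y) (P.map H) :=
        aemeasurable_of_measurable_univCompletion ((measurable_pi_apply y).comp hqm) _
      exact ⟨fun ω => hqy.mk _ (H ω),
        (hqy.measurable_mk.comp (comap_measurable H)).stronglyMeasurable,
        ae_of_ae_map hH.aemeasurable hqy.ae_eq_mk⟩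
    have hqb : ∀ y, ∀ᵐ ω ∂P, |q (H ω) y| ≤ 1 := fun y =>
      .of_forall fun ω => abs_le_one_of_mem_stdSimplex (hqs (H ω)) y
    simp only [sBrier_eq]
    rw [lintegral_ofReal_sum_sq_sub (fun y => (hqa y).mono hH.comap_le) hXm hqb hXb]
    refine ENNReal.ofReal_le_ofReal (Finset.sum_le_sum fun y _ => ?_)
    rw [integral_sq_sub_eq_add_condExp hH.comap_le (hqa y) (hqb y)
      (measurable_indicator_preimage hY y) (abs_indicator_preimage_le_one y)]
    exact le_add_of_nonneg_left (integral_nonneg fun ω => sq_nonneg _)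

end ReportRisk

end BrierGap

/-- Brier-score communication gap equals expected squared posterior error.
Assume `𝒴` finite and `M = g(H, ζ)` with `ζ` conditionally independent of `Y` given `H`. Then
`V(M; s_Br) − V(H; s_Br) = E[‖π_H − π_M‖₂²]`. -/
theorem brier_gap_eq_expected_sq_posterior_error
    {Ω ℋ ℳ 𝒵 𝒴 : Type*}
    [MeasurableSpace Ω] [StandardBorelSpace Ω] [Nonempty Ω]
    [mℋ : MeasurableSpace ℋ] [StandardBorelSpace ℋ]
    [mℳ : MeasurableSpace ℳ] [StandardBorelSpace ℳ]
    [MeasurableSpace 𝒵]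
    [Fintype 𝒴] [MeasurableSpace 𝒴] [DiscreteMeasurableSpace 𝒴]
    (P : Measure Ω) [IsProbabilityMeasure P]
    (Y : Ω → 𝒴) (hY : Measurable Y)
    (H : Ω → ℋ) (hH : Measurable H)
    (ζ : Ω → 𝒵) (hζ : Measurable ζ)
    (g : ℋ × 𝒵 → ℳ) (hg : Measurable g)
    (M : Ω → ℳ) (hM : M = fun ω => g (H ω, ζ ω))
    (hindep : CondIndepFun (MeasurableSpace.comap H mℋ) hH.comap_le ζ Y P) :
    ReportRisk mℳ P M Y sBrier - ReportRisk mℋ P H Y sBrier =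
      ∫⁻ ω, ENNReal.ofReal
        (∑ y, (posterior mℋ P H Y ω y - posterior mℳ P M Y ω y) ^ 2) ∂P := by
  have hK : Measurable fun ω => (H ω, ζ ω) := hH.prodMk hζ
  have hMm : Measurable M := hM ▸ hg.comp hK
  have hMle : MeasurableSpace.comap M mℳ ≤
      MeasurableSpace.comap (fun ω => (H ω, ζ ω)) Prod.instMeasurableSpace := by
    rintro _ ⟨s, hs, rfl⟩
    exact ⟨g ⁻¹' s, hg hs, by rw [hM]; rfl⟩
  have hsplit : ∀ y : 𝒴,
      ∫ ω, (posterior mℳ P M Y ω y - (Y ⁻¹' {y}).indicator (fun _ => (1 : ℝ)) ω) ^ 2 ∂P =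
        ∫ ω, (posterior mℋ P H Y ω y - posterior mℳ P M Y ω y) ^ 2 ∂P +
        ∫ ω, (posterior mℋ P H Y ω y - (Y ⁻¹' {y}).indicator (fun _ => (1 : ℝ)) ω) ^ 2 ∂P := by
    intro y
    have hce := BrierGap.condExp_comap_prodMk_of_condIndepFun hY hH hζ hindep
      (MeasurableSet.of_discrete (s := {y}))
    rw [BrierGap.integral_sq_sub_eq_add_condExp hK.comap_le
      ((BrierGap.stronglyMeasurable_posterior y).mono hMle).aestronglyMeasurable
      (BrierGap.ae_abs_posterior_le_one y)
      (BrierGap.measurable_indicator_preimage hY y) (BrierGap.abs_indicator_preimage_le_one y)]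
    congr 1
    · refine integral_congr_ae ?_
      filter_upwards [hce] with ω hω
      rw [← hω, sub_sq_comm]
      rfl
    · refine integral_congr_ae ?_
      filter_upwards [hce] with ω hω
      rw [← hω]
      rfl
  rw [BrierGap.reportRisk_sBrier hY hMm, BrierGap.reportRisk_sBrier hY hH,
    BrierGap.lintegral_ofReal_sum_sq_sub
      (fun y => ((BrierGap.stronglyMeasurable_posterior y).mono hH.comap_le).aestronglyMeasurable)
      (fun y => ((BrierGap.stronglyMeasurable_posterior y).mono hMm.comap_le).aestronglyMeasurable)
      (fun y => BrierGap.ae_abs_posterior_le_one y) (fun y => BrierGap.ae_abs_posterior_le_one y),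
    ← ENNReal.ofReal_sub _
      (Finset.sum_nonneg fun y _ => integral_nonneg fun ω => sq_nonneg _),
    Finset.sum_congr rfl fun y _ => hsplit y, Finset.sum_add_distrib, add_sub_cancel_right]
end

section
/- Assume 𝒴 is finite. Let M_0 = H and suppose Y → M_0 → M_1 → ⋯ → M_L is a Markov chain of information states with values in standard Borel spaces, with all expected log scores E[s_log(π_{M_k}, Y)] finite. Then the total log-loss communication gap along the chain is additive over stages: V(M_L; s_log) − V(M_0; s_log) = Σ_{ℓ=1}^{L} I(Y; M_{ℓ−1} | M_ℓ). -/
open MeasureTheory ProbabilityTheory ENNReal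

open Set

lemma MeasurableSpace.le_univCompletion {α : Type*} (m : MeasurableSpace α) :
    m ≤ m.univCompletion :=
  fun _ hs _ _ => MeasurableSet.nullMeasurableSet hs

lemma measurable_slog {𝒴 : Type*} (y : 𝒴) : Measurable fun q : 𝒴 → ℝ => slog q y := by
  unfold slog
  refine Measurable.ite ?_ measurable_const ?_
  · exact measurableSet_eq_fun (measurable_pi_apply y) measurable_const
  · exact ENNReal.measurable_ofReal.comp
      (Real.measurable_log.comp (measurable_pi_apply y)).neg

section Pointwise

variable {𝒴 : Type*} [Fintype 𝒴]

lemma ofReal_mul_slog {p q : 𝒴 → ℝ} (hp : p ∈ stdSimplex ℝ 𝒴) {y : 𝒴}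
    (h : q y = 0 → p y = 0) :
    ENNReal.ofReal (p y) * slog q y = ENNReal.ofReal (p y * -Real.log (q y)) := by
  by_cases hq : q y = 0
  · simp [h hq]
  · rw [ENNReal.ofReal_mul (hp.1 y)]
    simp [slog, hq]

lemma sum_ofReal_mul_slog {p q : 𝒴 → ℝ} (hp : p ∈ stdSimplex ℝ 𝒴) (hq : q ∈ stdSimplex ℝ 𝒴)
    (h : ∀ y, q y = 0 → p y = 0) :
    ∑ y, ENNReal.ofReal (p y) * slog q y = ENNReal.ofReal (∑ y, p y * -Real.log (q y)) := by
  rw [ENNReal.ofReal_sum_of_nonneg]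
  · exact Finset.sum_congr rfl fun y _ => ofReal_mul_slog hp (h y)
  · intro y _
    have hq1 : q y ≤ 1 := hq.2 ▸ Finset.single_le_sum (fun i _ => hq.1 i) (Finset.mem_univ y)
    exact mul_nonneg (hp.1 y) (neg_nonneg.2 (Real.log_nonpos (hq.1 y) hq1))

/-- Gibbs' inequality on a finite set. -/
lemma sum_mul_log_div_nonneg {p q : 𝒴 → ℝ} (hp : p ∈ stdSimplex ℝ 𝒴) (hq : q ∈ stdSimplex ℝ 𝒴)
    (h : ∀ y, q y = 0 → p y = 0) : 0 ≤ ∑ y, p y * Real.log (p y / q y) := by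
  have key : ∀ y, p y - q y ≤ p y * Real.log (p y / q y) := by
    intro y
    rcases (hp.1 y).eq_or_lt with h0 | h0
    · simp [← h0, hq.1 y]
    · have hq0 : 0 < q y := (hq.1 y).lt_of_ne fun h' => h0.ne' (h y h'.symm)
      have h1 := Real.one_sub_inv_le_log_of_pos (div_pos h0 hq0)
      have h2 := mul_le_mul_of_nonneg_left h1 h0.le
      have h3 : p y * (1 - (p y / q y)⁻¹) = p y - q y := by field_simp
      linarith
  calc (0 : ℝ) = ∑ y, (p y - q y) := by rw [Finset.sum_sub_distrib, hp.2, hq.2, sub_self]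
    _ ≤ _ := Finset.sum_le_sum fun y _ => key y

lemma sum_slog_eq_add_KLdiv {p q : 𝒴 → ℝ} (hp : p ∈ stdSimplex ℝ 𝒴)
    (hq : q ∈ stdSimplex ℝ 𝒴) :
    ∑ y, ENNReal.ofReal (p y) * slog q y =
      ∑ y, ENNReal.ofReal (p y) * slog p y + KLdiv p q := by
  by_cases hE : ∃ y, p y ≠ 0 ∧ q y = 0
  · obtain ⟨y, hy, hqy⟩ := hE
    have hK : KLdiv p q = ⊤ := if_pos ⟨y, hy, hqy⟩
    rw [hK, add_top, ENNReal.sum_eq_top]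
    refine ⟨y, Finset.mem_univ y, ?_⟩
    have hpos : 0 < p y := (hp.1 y).lt_of_ne hy.symm
    simp [slog, hqy, ENNReal.mul_top, hpos]
  · have h : ∀ y, q y = 0 → p y = 0 := by
      intro y hqy
      by_contra hpy
      exact hE ⟨y, hpy, hqy⟩
    have hK : KLdiv p q = ENNReal.ofReal (∑ y, p y * Real.log (p y / q y)) := if_neg hE
    have hlogp : 0 ≤ ∑ y, p y * -Real.log (p y) := Finset.sum_nonneg fun y _ =>
      mul_nonneg (hp.1 y) (neg_nonneg.2 (Real.log_nonpos (hp.1 y)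
        (hp.2 ▸ Finset.single_le_sum (fun i _ => hp.1 i) (Finset.mem_univ y))))
    rw [hK, sum_ofReal_mul_slog hp hq h, sum_ofReal_mul_slog hp hp fun _ => id,
      ← ENNReal.ofReal_add hlogp (sum_mul_log_div_nonneg hp hq h), ← Finset.sum_add_distrib]
    congr 1
    refine Finset.sum_congr rfl fun y _ => ?_
    by_cases hpy : p y = 0
    · simp [hpy]
    · rw [Real.log_div hpy (mt (h y) hpy)]
      ring

end Pointwise

section Conditional

variable {Ω : Type*} {m mΩ : MeasurableSpace Ω} {P : Measure Ω}

lemma condExp_indicator_one_nonneg (B : Set Ω) : 0 ≤ᵐ[P] P⟦B|m⟧ :=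
  condExp_nonneg (ae_of_all _ fun _ => indicator_nonneg (fun _ _ => zero_le_one) _)

variable [IsProbabilityMeasure P]

lemma setLIntegral_ofReal_condExp_indicator (hm : m ≤ mΩ) {B s : Set Ω}
    (hB : MeasurableSet B) (hs : MeasurableSet[m] s) :
    ∫⁻ ω in s, ENNReal.ofReal ((P⟦B|m⟧) ω) ∂P = P (B ∩ s) := by
  have hint : Integrable (B.indicator fun _ => (1 : ℝ)) P := (integrable_const 1).indicator hB
  rw [← ofReal_integral_eq_lintegral_ofReal integrable_condExp.integrableOn
      (ae_restrict_of_ae (condExp_indicator_one_nonneg B)),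
    setIntegral_condExp hm hint hs, integral_indicator hB, setIntegral_const,
    smul_eq_mul, mul_one, measureReal_restrict_apply hB, ofReal_measureReal]

/-- Disintegration of an event along a sub-σ-algebra, tested on nonnegative functions. -/
lemma setLIntegral_eq_lintegral_condExp_mul (hm : m ≤ mΩ) {B : Set Ω} (hB : MeasurableSet B)
    {f : Ω → ℝ≥0∞} (hf : Measurable[m] f) :
    ∫⁻ ω in B, f ω ∂P = ∫⁻ ω, ENNReal.ofReal ((P⟦B|m⟧) ω) * f ω ∂P := by
  have hmeas : Measurable fun ω => ENNReal.ofReal ((P⟦B|m⟧) ω) :=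
    (stronglyMeasurable_condExp.mono hm).measurable.ennreal_ofReal
  have htrim : (P.restrict B).trim hm =
      (P.withDensity fun ω => ENNReal.ofReal ((P⟦B|m⟧) ω)).trim hm := by
    refine @Measure.ext _ m _ _ fun s hs => ?_
    rw [trim_measurableSet_eq hm hs, trim_measurableSet_eq hm hs,
      withDensity_apply _ (hm s hs), setLIntegral_ofReal_condExp_indicator hm hB hs,
      Measure.restrict_apply (hm s hs), inter_comm]
  rw [← lintegral_trim hm hf, htrim, lintegral_trim hm hf,
    lintegral_withDensity_eq_lintegral_mul _ hmeas (hf.mono hm le_rfl)]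
  rfl

end Conditional

section Score

lemma measurable_slog_condExp {Ω 𝒴 : Type*} [Fintype 𝒴] (m : MeasurableSpace Ω)
    {_ : MeasurableSpace Ω} (P : Measure Ω) (Y : Ω → 𝒴) (y : 𝒴) :
    Measurable[m] fun ω => slog (fun y => (P⟦Y ⁻¹' {y}|m⟧) ω) y :=
  (measurable_slog y).comp <| @measurable_pi_lambda _ _ _ m _ _ fun _ =>
    stronglyMeasurable_condExp.measurable

variable {Ω 𝒴 : Type*} {m mΩ : MeasurableSpace Ω} [Fintype 𝒴] [MeasurableSpace 𝒴]
  [DiscreteMeasurableSpace 𝒴] {P : Measure Ω} [IsProbabilityMeasure P] {Y : Ω → 𝒴}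

lemma lintegral_eval_eq_lintegral_sum (hm : m ≤ mΩ) (hY : Measurable Y) {S : Ω → 𝒴 → ℝ≥0∞}
    (hS : ∀ y, Measurable[m] fun ω => S ω y) :
    ∫⁻ ω, S ω (Y ω) ∂P = ∫⁻ ω, ∑ y, ENNReal.ofReal ((P⟦Y ⁻¹' {y}|m⟧) ω) * S ω y ∂P := by
  classical
  have hB : ∀ y, MeasurableSet (Y ⁻¹' {y}) := fun y => hY (measurableSet_singleton y)
  have hS' : ∀ y, Measurable fun ω => S ω y := fun y => (hS y).mono hm le_rfl
  have hsum : ∀ ω, S ω (Y ω) = ∑ y, (Y ⁻¹' {y}).indicator (fun ω => S ω y) ω := by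
    intro ω
    simp [indicator_apply]
  rw [lintegral_congr hsum, lintegral_finsetSum _ fun y _ => (hS' y).indicator (hB y),
    lintegral_finsetSum]
  · refine Finset.sum_congr rfl fun y _ => ?_
    rw [lintegral_indicator (hB y), setLIntegral_eq_lintegral_condExp_mul hm (hB y) (hS y)]
  · intro y _
    exact (stronglyMeasurable_condExp.mono hm).measurable.ennreal_ofReal.mul (hS' y)

lemma condExp_mem_stdSimplex (hm : m ≤ mΩ) (hY : Measurable Y) :
    ∀ᵐ ω ∂P, (fun y => (P⟦Y ⁻¹' {y}|m⟧) ω) ∈ stdSimplex ℝ 𝒴 := by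
  classical
  have hB : ∀ y, MeasurableSet (Y ⁻¹' {y}) := fun y => hY (measurableSet_singleton y)
  have hone : ∑ y, (Y ⁻¹' {y}).indicator (fun _ => (1 : ℝ)) = fun _ => (1 : ℝ) := by
    ext ω
    simp [indicator_apply]
  have hsum := condExp_finsetSum (μ := P) (s := Finset.univ)
    (f := fun y => (Y ⁻¹' {y}).indicator fun _ => (1 : ℝ))
    (fun y _ => (integrable_const 1).indicator (hB y)) m
  rw [hone, condExp_const hm] at hsum
  filter_upwards [hsum, ae_all_iff.2 fun y => condExp_indicator_one_nonneg (P := P) (m := m)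
    (Y ⁻¹' {y})] with ω h1 h2
  exact ⟨h2, by simpa using h1.symm⟩

/-- Coarsening the information costs the expected Kullback–Leibler divergence between the two
posteriors. -/
lemma lintegral_slog_condExp_eq_add (hY : Measurable Y) {m' : MeasurableSpace Ω} (hmm' : m ≤ m')
    (hm' : m' ≤ mΩ) :
    ∫⁻ ω, slog (fun y => (P⟦Y ⁻¹' {y}|m⟧) ω) (Y ω) ∂P =
      ∫⁻ ω, slog (fun y => (P⟦Y ⁻¹' {y}|m'⟧) ω) (Y ω) ∂P +
        ∫⁻ ω, KLdiv (fun y => (P⟦Y ⁻¹' {y}|m'⟧) ω) (fun y => (P⟦Y ⁻¹' {y}|m⟧) ω) ∂P := by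
  rw [lintegral_eval_eq_lintegral_sum hm' hY
      (S := fun ω => slog fun y => (P⟦Y ⁻¹' {y}|m⟧) ω)
      fun y => (measurable_slog_condExp m P Y y).mono hmm' le_rfl,
    lintegral_eval_eq_lintegral_sum hm' hY
      (S := fun ω => slog fun y => (P⟦Y ⁻¹' {y}|m'⟧) ω)
      (measurable_slog_condExp m' P Y), ← lintegral_add_left]
  · refine lintegral_congr_ae ?_
    filter_upwards [condExp_mem_stdSimplex (P := P) hm' hY,
      condExp_mem_stdSimplex (P := P) (hmm'.trans hm') hY] with ω h1 h2
    exact sum_slog_eq_add_KLdiv h1 h2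
  · exact Finset.measurable_fun_sum _ fun y _ =>
      (stronglyMeasurable_condExp.mono hm').measurable.ennreal_ofReal.mul
        ((measurable_slog_condExp m' P Y y).mono hm' le_rfl)

end Score

/-- The Bayes risk under log loss is attained at the posterior. -/
lemma reportRisk_slog_eq {Ω ℋ 𝒴 : Type*} [MeasurableSpace Ω] [mℋ : MeasurableSpace ℋ]
    [Fintype 𝒴] [MeasurableSpace 𝒴] [DiscreteMeasurableSpace 𝒴] {P : Measure Ω}
    [IsProbabilityMeasure P] {H : Ω → ℋ} (hH : Measurable H) {Y : Ω → 𝒴} (hY : Measurable Y) :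
    ReportRisk mℋ P H Y slog = ∫⁻ ω, slog (posterior mℋ P H Y ω) (Y ω) ∂P := by
  classical
  have hm := hH.comap_le
  refine le_antisymm ?_ (le_iInf fun q => ?_)
  · have : Nonempty 𝒴 := (nonempty_of_isProbabilityMeasure P).map Y
    obtain ⟨y₀⟩ := this
    have hfac : ∀ y, ∃ h : ℋ → ℝ, StronglyMeasurable h ∧
        P⟦Y ⁻¹' {y}|mℋ.comap H⟧ = h ∘ H := fun y =>
      (stronglyMeasurable_condExp (m := mℋ.comap H)).exists_eq_measurable_comp
    choose g hg hgH using hfac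
    have hgm : Measurable fun h y => g y h := measurable_pi_lambda _ fun y => (hg y).measurable
    let q : ℋ → 𝒴 → ℝ := fun h =>
      if (fun y => g y h) ∈ stdSimplex ℝ 𝒴 then fun y => g y h else Pi.single y₀ 1
    have hq : Measurable q :=
      Measurable.ite (hgm (isClosed_stdSimplex ℝ 𝒴).measurableSet) hgm measurable_const
    have hqs : ∀ h, q h ∈ stdSimplex ℝ 𝒴 := by
      intro h
      by_cases hh : (fun y => g y h) ∈ stdSimplex ℝ 𝒴
      · simpa only [q, if_pos hh] using hh
      · simpa only [q, if_neg hh] using single_mem_stdSimplex ℝ y₀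
    refine (iInf_le _ ⟨q, hq.mono mℋ.le_univCompletion le_rfl, hqs⟩).trans_eq ?_
    refine lintegral_congr_ae ?_
    filter_upwards [condExp_mem_stdSimplex (P := P) hm hY] with ω hω
    have hpost : posterior mℋ P H Y ω = fun y => g y (H ω) :=
      funext fun y => congrFun (hgH y) ω
    have hω' : (fun y => g y (H ω)) ∈ stdSimplex ℝ 𝒴 := hpost ▸ hω
    simp only [q, if_pos hω', hpost]
  · have hnull : NullMeasurable q.1 (P.map H) := fun s hs =>
      q.2.1 hs (P.map H) inferInstance
    have hae : AEMeasurable q.1 (P.map H) := hnull.aemeasurable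
    have heq : ∀ᵐ ω ∂P, q.1 (H ω) = hae.mk q.1 (H ω) := ae_of_ae_map hH.aemeasurable hae.ae_eq_mk
    have hlow : ∫⁻ ω, slog (q.1 (H ω)) (Y ω) ∂P =
        ∫⁻ ω, slog (hae.mk q.1 (H ω)) (Y ω) ∂P := by
      refine lintegral_congr_ae ?_
      filter_upwards [heq] with ω hω
      rw [hω]
    have hmk : ∀ y, Measurable[mℋ.comap H] fun ω => slog (hae.mk q.1 (H ω)) y := fun y =>
      ((measurable_slog y).comp hae.measurable_mk).comp (comap_measurable H)
    have hpost : ∫⁻ ω, slog (posterior mℋ P H Y ω) (Y ω) ∂P = _ :=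
      lintegral_eval_eq_lintegral_sum hm hY (measurable_slog_condExp (mℋ.comap H) P Y)
    rw [hlow, lintegral_eval_eq_lintegral_sum hm hY hmk, hpost]
    refine lintegral_mono_ae ?_
    filter_upwards [heq, condExp_mem_stdSimplex (P := P) hm hY] with ω h1 h2
    exact le_self_add.trans_eq (sum_slog_eq_add_KLdiv h2 (h1 ▸ q.2.2 (H ω))).symm

/-- Under conditional independence, adjoining `T` to the information `X` does not change the
conditional probabilities of `Y`. -/
lemma CondIndepFun.condExp_prodMk_eq {Ω α β 𝒴 : Type*} [MeasurableSpace Ω] [StandardBorelSpace Ω]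
    [mα : MeasurableSpace α] [mβ : MeasurableSpace β] [MeasurableSpace 𝒴] {P : Measure Ω}
    [IsProbabilityMeasure P] {X : Ω → α} (hX : Measurable X) {T : Ω → β} (hT : Measurable T)
    {Y : Ω → 𝒴} (hY : Measurable Y) (hind : CondIndepFun (mα.comap X) hX.comap_le T Y P)
    {A : Set 𝒴} (hA : MeasurableSet A) :
    P⟦Y ⁻¹' A|mα.comap X⟧ =ᵐ[P]
      P⟦Y ⁻¹' A|MeasurableSpace.comap (fun ω => (X ω, T ω)) inferInstance⟧ := by
  have hXT : Measurable fun ω => (X ω, T ω) := hX.prodMk hT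
  have hm := hX.comap_le
  have hle : mα.comap X ≤ MeasurableSpace.comap (fun ω => (X ω, T ω)) inferInstance :=
    le_sup_left.trans_eq (MeasurableSpace.comap_prodMk X T).symm
  have hB : MeasurableSet (Y ⁻¹' A) := hY hA
  have hmeas : Measurable[mα.comap X] fun ω => ENNReal.ofReal ((P⟦Y ⁻¹' A|mα.comap X⟧) ω) :=
    stronglyMeasurable_condExp.measurable.ennreal_ofReal
  let d : Ω → ℝ≥0∞ := fun ω => ENNReal.ofReal ((P⟦Y ⁻¹' A|mα.comap X⟧) ω)
  have hfin : IsFiniteMeasure (P.withDensity d) := by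
    refine isFiniteMeasure_withDensity ?_
    rw [← setLIntegral_univ, setLIntegral_ofReal_condExp_indicator hm hB MeasurableSet.univ]
    exact measure_ne_top _ _
  have hmap : (P.withDensity d).map (fun ω => (X ω, T ω)) =
      (P.restrict (Y ⁻¹' A)).map (fun ω => (X ω, T ω)) := by
    refine Measure.ext_prod fun {s t} hs ht => ?_
    have hS : MeasurableSet[mα.comap X] (X ⁻¹' s) := ⟨s, hs, rfl⟩
    have hTt : MeasurableSet (T ⁻¹' t) := hT ht
    have hpre : (fun ω => (X ω, T ω)) ⁻¹' s ×ˢ t = X ⁻¹' s ∩ T ⁻¹' t := rfl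
    rw [Measure.map_apply hXT (hs.prod ht), Measure.map_apply hXT (hs.prod ht), hpre,
      withDensity_apply _ ((hX hs).inter hTt), Measure.restrict_apply ((hX hs).inter hTt)]
    have hmul := (condIndepFun_iff_condExp_inter_preimage_eq_mul hT hY).1 hind t A ht hA
    calc ∫⁻ ω in X ⁻¹' s ∩ T ⁻¹' t, d ω ∂P
        = ∫⁻ ω in T ⁻¹' t, (X ⁻¹' s).indicator d ω ∂P := by
          rw [lintegral_indicator (hX hs), Measure.restrict_restrict (hX hs)]
      _ = ∫⁻ ω, ENNReal.ofReal ((P⟦T ⁻¹' t|mα.comap X⟧) ω) * (X ⁻¹' s).indicator d ω ∂P :=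
          setLIntegral_eq_lintegral_condExp_mul hm hTt (hmeas.indicator hS)
      _ = ∫⁻ ω, (X ⁻¹' s).indicator (fun ω =>
            ENNReal.ofReal ((P⟦T ⁻¹' t ∩ Y ⁻¹' A|mα.comap X⟧) ω)) ω ∂P := by
          refine lintegral_congr_ae ?_
          filter_upwards [hmul, condExp_indicator_one_nonneg (P := P) (m := mα.comap X)
            (T ⁻¹' t)] with ω h1 h2
          by_cases hω : ω ∈ X ⁻¹' s
          · simp only [indicator_of_mem hω, d]
            rw [h1, ENNReal.ofReal_mul h2]
          · simp only [indicator_of_notMem hω, mul_zero]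
      _ = P (X ⁻¹' s ∩ T ⁻¹' t ∩ Y ⁻¹' A) := by
          rw [lintegral_indicator (hX hs),
            setLIntegral_ofReal_condExp_indicator hm (hTt.inter hB) hS, inter_comm, inter_assoc]
  have hint : Integrable ((Y ⁻¹' A).indicator fun _ => (1 : ℝ)) P :=
    (integrable_const 1).indicator hB
  refine ae_eq_condExp_of_forall_setIntegral_eq hXT.comap_le hint
    (fun _ _ _ => integrable_condExp.integrableOn) ?_
    (stronglyMeasurable_condExp.mono hle).aestronglyMeasurable
  rintro _ ⟨u, hu, rfl⟩ -
  have hu' := hXT hu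
  have hmapu := congrArg (fun ν => ν u) hmap
  simp only [Measure.map_apply hXT hu, withDensity_apply _ hu',
    Measure.restrict_apply hu'] at hmapu
  rw [integral_eq_lintegral_of_nonneg_ae
      (ae_restrict_of_ae (condExp_indicator_one_nonneg _))
      integrable_condExp.integrableOn.aestronglyMeasurable,
    integral_indicator hB, setIntegral_const, smul_eq_mul, mul_one,
    Measure.real, Measure.restrict_apply hB, inter_comm (Y ⁻¹' A), ← hmapu]

lemma Fin.last_eq_add_sum {R : Type*} [AddCommMonoid R] {n : ℕ} (r : Fin (n + 1) → R)
    (d : Fin n → R) (h : ∀ k, r k.succ = r k.castSucc + d k) :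
    r (Fin.last n) = r 0 + ∑ k, d k := by
  induction n with
  | zero => simp
  | succ n ih =>
    have := ih (fun k => r k.castSucc) (fun k => d k.castSucc) fun k => h k.castSucc
    rw [Fin.sum_univ_castSucc, ← add_assoc, ← Fin.castSucc_zero, ← this, ← Fin.succ_last, h]

/-- serial communication under log loss is additive. Assume `𝒴` finite.
Let `M 0 = H` and suppose `Y → M 0 → M 1 → ⋯ → M L` is a Markov chain of information states
with values in standard Borel spaces (for each `k`, `M (k+1)` is conditionally independent of
`Y` given `M k`), with all expected log scores at the posteriors finite. Then
`V(M L; s_log) − V(M 0; s_log) = Σ_{k=1}^{L} I(Y; M (k-1) | M k)`, where each conditional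
mutual information term is the expected KL divergence between the posterior given
`(M (k-1), M k)` and the posterior given `M k`. -/
theorem serial_log_loss_gap_additive
    {Ω 𝒴 : Type*} {L : ℕ} {𝓜 : Fin (L + 1) → Type*}
    [MeasurableSpace Ω] [StandardBorelSpace Ω] [Nonempty Ω]
    [m𝓜 : ∀ k, MeasurableSpace (𝓜 k)] [∀ k, StandardBorelSpace (𝓜 k)]
    [Fintype 𝒴] [MeasurableSpace 𝒴] [DiscreteMeasurableSpace 𝒴]
    (P : Measure Ω) [IsProbabilityMeasure P]
    (Y : Ω → 𝒴) (hY : Measurable Y)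
    (M : ∀ k, Ω → 𝓜 k) (hMmeas : ∀ k, Measurable (M k))
    (hMarkov : ∀ k : Fin L,
      CondIndepFun (MeasurableSpace.comap (M k.castSucc) (m𝓜 k.castSucc))
        (hMmeas k.castSucc).comap_le (M k.succ) Y P)
    (hfin : ∀ k, ∫⁻ ω, slog (posterior (m𝓜 k) P (M k) Y ω) (Y ω) ∂P ≠ ⊤) :
    ReportRisk (m𝓜 (Fin.last L)) P (M (Fin.last L)) Y slog -
        ReportRisk (m𝓜 0) P (M 0) Y slog =
      ∑ k : Fin L,
        ∫⁻ ω, KLdiv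
          (posterior (inferInstance : MeasurableSpace (𝓜 k.castSucc × 𝓜 k.succ)) P
            (fun ω' => (M k.castSucc ω', M k.succ ω')) Y ω)
          (posterior (m𝓜 k.succ) P (M k.succ) Y ω) ∂P := by
  rw [reportRisk_slog_eq (hMmeas _) hY, reportRisk_slog_eq (hMmeas _) hY,
    Fin.last_eq_add_sum (fun k => ∫⁻ ω, slog (posterior (m𝓜 k) P (M k) Y ω) (Y ω) ∂P) _
      fun k => ?_]
  · exact ENNReal.add_sub_cancel_left (hfin 0)
  · have hpair : Measurable fun ω => (M k.castSucc ω, M k.succ ω) :=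
      (hMmeas k.castSucc).prodMk (hMmeas k.succ)
    have hle : (m𝓜 k.succ).comap (M k.succ) ≤
        MeasurableSpace.comap (fun ω => (M k.castSucc ω, M k.succ ω)) inferInstance :=
      le_sup_right.trans_eq (MeasurableSpace.comap_prodMk _ _).symm
    refine (lintegral_slog_condExp_eq_add hY hle hpair.comap_le).trans ?_
    congr 1
    refine lintegral_congr_ae ?_
    filter_upwards [ae_all_iff.2 fun y => CondIndepFun.condExp_prodMk_eq (hMmeas k.castSucc)
      (hMmeas k.succ) hY (hMarkov k) (measurableSet_singleton y)] with ω hω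
    exact congrArg (fun q => slog q (Y ω)) (funext fun y => (hω y).symm)
end
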